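/- arXiv:1001.3344 — 2 statements merged into one kernel-verified Lean document; each statement's English description precedes it below -/
import Mathlib

section
/- Existence and uniqueness for rough differential equations (Theorem 2.6(1), Davie formulation): Let 1/3 < κ < γ ≤ 1, T > 0, let (x, X²) be a γ-rough path over [0,T] with values in ℝ^m, let σ ∈ C³(ℝ^d; ℝ^{d×m}) be bounded with bounded derivatives up to order three, and let a ∈ ℝ^d. Then there exists exactly one continuous path y : [0,T] → ℝ^d which is a solution with exponent 3κ of the rough differential equation dy = σ(y)dx with y_0 = a. -/
open Set
open scoped ENNReal

noncomputable section

/-- `ℝ^m` with the Euclidean norm. -/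
abbrev Vec (m : ℕ) := EuclideanSpace ℝ (Fin m)

/-- `ℝ^{m×m}` with the Euclidean norm. -/
abbrev Mat (m : ℕ) := EuclideanSpace ℝ (Fin m × Fin m)

/-- Sup "norm" `sup_{t ∈ [a,b]} ‖f t‖` as an extended nonnegative real. -/
noncomputable def supENorm {E : Type*} [NormedAddCommGroup E] (a b : ℝ) (f : ℝ → E) : ℝ≥0∞ :=
  ⨆ t : Icc a b, ENNReal.ofReal ‖f t‖

/-- γ-Hölder seminorm `sup_{a ≤ s < t ≤ b} ‖f t - f s‖/(t-s)^γ` as an extended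
nonnegative real. -/
noncomputable def holderENorm {E : Type*} [NormedAddCommGroup E] (γ a b : ℝ) (f : ℝ → E) :
    ℝ≥0∞ :=
  ⨆ p : {p : ℝ × ℝ // a ≤ p.1 ∧ p.1 < p.2 ∧ p.2 ≤ b},
    ENNReal.ofReal (‖f p.1.2 - f p.1.1‖ / (p.1.2 - p.1.1) ^ γ)

/-- Hölder seminorm `sup_{a ≤ s < t ≤ b} ‖X_{st}‖/(t-s)^β` of a two-parameter function,
as an extended nonnegative real. -/
noncomputable def holder2ENorm {E : Type*} [NormedAddCommGroup E] (β a b : ℝ)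
    (X : ℝ → ℝ → E) : ℝ≥0∞ :=
  ⨆ p : {p : ℝ × ℝ // a ≤ p.1 ∧ p.1 < p.2 ∧ p.2 ≤ b},
    ENNReal.ofReal (‖X p.1.1 p.1.2‖ / (p.1.2 - p.1.1) ^ β)

/-- The real-valued γ-Hölder norm `‖f‖_{γ,∞} = sup ‖f‖ + Hölder seminorm` on `[a,b]`. -/
noncomputable def holderInftyNorm {E : Type*} [NormedAddCommGroup E] (γ a b : ℝ)
    (f : ℝ → E) : ℝ :=
  (supENorm a b f + holderENorm γ a b f).toReal

/-- A γ-rough path `(x, X²)` over `[a,b]` with values in `ℝ^m`: `x` has finite γ-Hölder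
seminorm, `X²` is continuous on the simplex with finite 2γ-Hölder seminorm and Chen's
relation holds. -/
def IsRoughPath (m : ℕ) (γ a b : ℝ) (x : ℝ → Vec m) (X2 : ℝ → ℝ → Mat m) : Prop :=
  holderENorm γ a b x < ⊤ ∧
  ContinuousOn (fun p : ℝ × ℝ => X2 p.1 p.2)
    {p : ℝ × ℝ | a ≤ p.1 ∧ p.1 ≤ p.2 ∧ p.2 ≤ b} ∧
  holder2ENorm (2 * γ) a b X2 < ⊤ ∧
  ∀ s u t : ℝ, a ≤ s → s ≤ u → u ≤ t → t ≤ b → ∀ i j : Fin m,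
    X2 s t (i, j) - X2 s u (i, j) - X2 u t (i, j) = (x u i - x s i) * (x t j - x u j)

/-- `σ` is `C³`, bounded with bounded derivatives up to order three. -/
def IsC3Bounded {E F : Type*} [NormedAddCommGroup E] [NormedSpace ℝ E]
    [NormedAddCommGroup F] [NormedSpace ℝ F] (σ : E → F) : Prop :=
  ContDiff ℝ 3 σ ∧ ∀ n : ℕ, n ≤ 3 → ∃ B : ℝ, ∀ z : E, ‖iteratedFDeriv ℝ n σ z‖ ≤ B

/-- The vector field `D^{(i)}σ^{(j)} = ∑_l σ^{(i)}_l ∂_l σ^{(j)}`, i.e. the derivative of the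
`j`-th column of `σ` in the direction of the `i`-th column. -/
noncomputable def Dvf (d m : ℕ) (σ : Vec d → Vec m →L[ℝ] Vec d) (i j : Fin m)
    (z : Vec d) : Vec d :=
  fderiv ℝ (fun w => σ w (EuclideanSpace.single j (1 : ℝ))) z
    (σ z (EuclideanSpace.single i (1 : ℝ)))

/-- `y` is a solution, with exponent `θ`, of the rough differential equation `dy = σ(y)dx`,
`y_0 = a`, on `[0,T]` (Davie's formulation). -/
def IsRDESolution (d m : ℕ) (θ T : ℝ) (σ : Vec d → Vec m →L[ℝ] Vec d) (x : ℝ → Vec m)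
    (X2 : ℝ → ℝ → Mat m) (a : Vec d) (y : ℝ → Vec d) : Prop :=
  ContinuousOn y (Icc 0 T) ∧ y 0 = a ∧
  ∃ C : ℝ, ∀ s t : ℝ, 0 ≤ s → s ≤ t → t ≤ T →
    ‖y t - y s - σ (y s) (x t - x s) -
        ∑ i : Fin m, ∑ j : Fin m, X2 s t (i, j) • Dvf d m σ i j (y s)‖
      ≤ C * (t - s) ^ θ


section Abstract

set_option linter.unusedSectionVars false

variable {E F G U : Type*} [NormedAddCommGroup E] [NormedSpace ℝ E]
  [NormedAddCommGroup F] [NormedSpace ℝ F] [NormedAddCommGroup G] [NormedSpace ℝ G]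
  [NormedAddCommGroup U] [NormedSpace ℝ U]

/-- Bounded, Lipschitz, and with a four-point estimate. -/
structure Nice (M : ℝ) (f : E → F) : Prop where
  bdd : ∀ z, ‖f z‖ ≤ M
  lip : ∀ z w, ‖f z - f w‖ ≤ M * ‖z - w‖
  four : ∀ A B A' B', ‖f A - f B - (f A' - f B')‖ ≤
    M * (‖A - B - (A' - B')‖ + (‖A - A'‖ + ‖B - B'‖) * ‖A' - B'‖)

theorem Nice.nonneg {M : ℝ} {f : E → F} (h : Nice M f) : 0 ≤ M :=
  (norm_nonneg _).trans (h.bdd 0)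

theorem Nice.mono {M M' : ℝ} {f : E → F} (h : Nice M f) (hM : M ≤ M') : Nice M' f where
  bdd z := (h.bdd z).trans hM
  lip z w := (h.lip z w).trans (by gcongr)
  four A B A' B' := (h.four A B A' B').trans (by gcongr)

theorem Nice.add {M M' : ℝ} {f g : E → F} (h : Nice M f) (h' : Nice M' g) :
    Nice (M + M') (fun z => f z + g z) where
  bdd z := (norm_add_le _ _).trans (add_le_add (h.bdd z) (h'.bdd z))
  lip z w := by
    have : f z + g z - (f w + g w) = (f z - f w) + (g z - g w) := by abel
    rw [this, add_mul]
    exact (norm_add_le _ _).trans (add_le_add (h.lip z w) (h'.lip z w))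
  four A B A' B' := by
    have : f A + g A - (f B + g B) - (f A' + g A' - (f B' + g B')) =
      (f A - f B - (f A' - f B')) + (g A - g B - (g A' - g B')) := by abel
    rw [this, add_mul]
    exact (norm_add_le _ _).trans (add_le_add (h.four _ _ _ _) (h'.four _ _ _ _))

theorem Nice.zero : Nice 0 (fun _ : E => (0 : F)) where
  bdd z := by simp
  lip z w := by simp
  four A B A' B' := by simp

theorem Nice.sum {ι : Type*} (s : Finset ι) {M : ι → ℝ} {f : ι → E → F}
    (h : ∀ i ∈ s, Nice (M i) (f i)) : Nice (∑ i ∈ s, M i) (fun z => ∑ i ∈ s, f i z) := by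
  classical
  induction s using Finset.induction_on with
  | empty => simpa using (Nice.zero : Nice 0 (fun _ : E => (0 : F)))
  | insert a s ha ih =>
    simp only [Finset.sum_insert ha]
    exact (h a (by simp)).add (ih fun i hi => h i (by simp [hi]))

theorem Nice.clm {M : ℝ} {f : E → F} (h : Nice M f) (l : F →L[ℝ] G) :
    Nice (‖l‖ * M) (fun z => l (f z)) where
  bdd z := (l.le_opNorm _).trans (by gcongr; exact h.bdd z)
  lip z w := by
    rw [← map_sub, mul_assoc]
    exact (l.le_opNorm _).trans (by gcongr; exact h.lip z w)
  four A B A' B' := by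
    rw [← map_sub, ← map_sub, ← map_sub, mul_assoc]
    exact (l.le_opNorm _).trans (by gcongr; exact h.four _ _ _ _)

theorem Nice.eval {M : ℝ} {f : E → U →L[ℝ] F} (h : Nice M f) (b : U) :
    Nice (‖b‖ * M) (fun z => f z b) := by
  have := (h.clm (ContinuousLinearMap.apply ℝ F b))
  refine Nice.mono (by simpa using this) ?_
  have h0 := h.nonneg
  gcongr
  refine ContinuousLinearMap.opNorm_le_bound _ (norm_nonneg _) fun l => ?_
  simpa [mul_comm] using l.le_opNorm b

theorem Nice.smul {M : ℝ} {f : E → F} (h : Nice M f) (c : ℝ) :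
    Nice (|c| * M) (fun z => c • f z) where
  bdd z := by
    rw [norm_smul, Real.norm_eq_abs]; gcongr; exact h.bdd z
  lip z w := by
    rw [← smul_sub, mul_assoc, norm_smul, Real.norm_eq_abs]; gcongr; exact h.lip z w
  four A B A' B' := by
    rw [← smul_sub, ← smul_sub, ← smul_sub, mul_assoc, norm_smul, Real.norm_eq_abs]
    gcongr; exact h.four _ _ _ _

theorem Nice.apply {M : ℝ} {P : E → F →L[ℝ] G} {Q : E → F} (hP : Nice M P) (hQ : Nice M Q) :
    Nice (3 * M ^ 2) (fun z => P z (Q z)) where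
  bdd z := by
    have h0 := hP.nonneg
    calc ‖P z (Q z)‖ ≤ ‖P z‖ * ‖Q z‖ := (P z).le_opNorm _
      _ ≤ M * M := by gcongr; exacts [hP.bdd z, hQ.bdd z]
      _ ≤ _ := by nlinarith
  lip z w := by
    have h0 := hP.nonneg
    have e : P z (Q z) - P w (Q w) = (P z - P w) (Q z) + P w (Q z - Q w) := by
      simp
    rw [e]
    calc _ ≤ ‖(P z - P w) (Q z)‖ + ‖P w (Q z - Q w)‖ := norm_add_le _ _
      _ ≤ ‖P z - P w‖ * ‖Q z‖ + ‖P w‖ * ‖Q z - Q w‖ :=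
        add_le_add (ContinuousLinearMap.le_opNorm _ _) (ContinuousLinearMap.le_opNorm _ _)
      _ ≤ (M * ‖z - w‖) * M + M * (M * ‖z - w‖) := by
        gcongr
        exacts [hP.lip _ _, hQ.bdd _, hP.bdd _, hQ.lip _ _]
      _ ≤ _ := by nlinarith [mul_nonneg (sq_nonneg M) (norm_nonneg (z - w))]
  four A B A' B' := by
    have h0 := hP.nonneg
    have e : P A (Q A) - P B (Q B) - (P A' (Q A') - P B' (Q B')) =
        (P A - P B - (P A' - P B')) (Q A) + (P A' - P B') (Q A - Q A')
        + P B (Q A - Q B - (Q A' - Q B')) + (P B - P B') (Q A' - Q B') := by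
      simp only [sub_apply, map_sub]; abel
    rw [e]
    calc _ ≤ ‖(P A - P B - (P A' - P B')) (Q A)‖ + ‖(P A' - P B') (Q A - Q A')‖
        + ‖P B (Q A - Q B - (Q A' - Q B'))‖ + ‖(P B - P B') (Q A' - Q B')‖ := norm_add₄_le
      _ ≤ ‖P A - P B - (P A' - P B')‖ * ‖Q A‖ + ‖P A' - P B'‖ * ‖Q A - Q A'‖
        + ‖P B‖ * ‖Q A - Q B - (Q A' - Q B')‖ + ‖P B - P B'‖ * ‖Q A' - Q B'‖ := by
          gcongr <;> exact ContinuousLinearMap.le_opNorm _ _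
      _ ≤ (M * (‖A - B - (A' - B')‖ + (‖A - A'‖ + ‖B - B'‖) * ‖A' - B'‖)) * M
        + (M * ‖A' - B'‖) * (M * ‖A - A'‖)
        + M * (M * (‖A - B - (A' - B')‖ + (‖A - A'‖ + ‖B - B'‖) * ‖A' - B'‖))
        + (M * ‖B - B'‖) * (M * ‖A' - B'‖) := by
          gcongr
          exacts [hP.four _ _ _ _, hQ.bdd _, hP.lip _ _, hQ.lip _ _, hP.bdd _, hQ.four _ _ _ _,
            hP.lip _ _, hQ.lip _ _]
      _ ≤ _ := by
        nlinarith [mul_nonneg (sq_nonneg M) (norm_nonneg (A - B - (A' - B')))]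

theorem Nice.of_fderiv {M : ℝ} {f : E → F} {f' : E → E →L[ℝ] F}
    (hd : ∀ z, HasFDerivAt f (f' z) z) (hb : ∀ z, ‖f z‖ ≤ M) (hb' : ∀ z, ‖f' z‖ ≤ M)
    (hl : ∀ z w, ‖f' z - f' w‖ ≤ M * ‖z - w‖) : Nice M f where
  bdd := hb
  lip z w := by
    exact Convex.norm_image_sub_le_of_norm_hasFDerivWithin_le
      (fun x _ => (hd x).hasFDerivWithinAt) (fun x _ => hb' x) convex_univ
      (mem_univ w) (mem_univ z)
  four A B A' B' := by
    have h0 : 0 ≤ M := (norm_nonneg _).trans (hb 0)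
    have hline : ∀ (P Q : E) (r : ℝ), HasDerivAt (fun r : ℝ => f (P + r • (Q - P)))
        (f' (P + r • (Q - P)) (Q - P)) r := by
      intro P Q r
      have h1 : HasDerivAt (fun r : ℝ => P + r • (Q - P)) (Q - P) r := by
        simpa using ((hasDerivAt_id r).smul_const (Q - P)).const_add P
      exact (hd _).comp_hasDerivAt r h1
    have key := norm_image_sub_le_of_norm_deriv_le_segment_01'
      (f := fun r : ℝ => f (B + r • (A - B)) - f (B' + r • (A' - B')))
      (C := M * (‖A - B - (A' - B')‖ + (‖A - A'‖ + ‖B - B'‖) * ‖A' - B'‖))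
      (fun r _ => ((hline B A r).sub (hline B' A' r)).hasDerivWithinAt) ?_
    · simp only [one_smul, zero_smul, add_zero, add_sub_cancel] at key
      convert key using 2
      abel
    · rintro r ⟨hr0, hr1⟩
      have e : f' (B + r • (A - B)) (A - B) - f' (B' + r • (A' - B')) (A' - B') =
        f' (B + r • (A - B)) (A - B - (A' - B')) +
        (f' (B + r • (A - B)) - f' (B' + r • (A' - B'))) (A' - B') := by
        simp only [sub_apply, map_sub]; abel
      rw [e]
      have e2 : ‖B + r • (A - B) - (B' + r • (A' - B'))‖ ≤ ‖A - A'‖ + ‖B - B'‖ := by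
        have : B + r • (A - B) - (B' + r • (A' - B')) = r • (A - A') + (1 - r) • (B - B') := by
          module
        rw [this]
        refine (norm_add_le _ _).trans ?_
        rw [norm_smul, norm_smul, Real.norm_of_nonneg hr0, Real.norm_of_nonneg (by linarith)]
        nlinarith [norm_nonneg (A - A'), norm_nonneg (B - B')]
      calc _ ≤ ‖f' (B + r • (A - B)) (A - B - (A' - B'))‖ +
          ‖(f' (B + r • (A - B)) - f' (B' + r • (A' - B'))) (A' - B')‖ := norm_add_le _ _
        _ ≤ M * ‖A - B - (A' - B')‖ + (M * (‖A - A'‖ + ‖B - B'‖)) * ‖A' - B'‖ := by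
          gcongr
          · exact (ContinuousLinearMap.le_opNorm _ _).trans (by gcongr; exact hb' _)
          · refine (ContinuousLinearMap.le_opNorm _ _).trans ?_
            gcongr
            exact (hl _ _).trans (by gcongr)
        _ = _ := by ring

/-- Second order Taylor remainder: Lipschitz estimate. -/
theorem remainder_lip {M : ℝ} {f : E → F} {D : E → E →L[ℝ] F}
    (hd : ∀ z, HasFDerivAt f (D z) z) (hD : Nice M D) (z w h k : E) :
    ‖(f (z + h) - f z - D z h) - (f (w + k) - f w - D w k)‖ ≤
      M * (‖h - k‖ + (2 * ‖z - w‖ + ‖h - k‖) * ‖k‖) * ‖h‖ + M * ‖k‖ * ‖h - k‖ := by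
  have h0 := hD.nonneg
  have hline : ∀ (P Q : E) (r : ℝ), HasDerivAt (fun r : ℝ => f (P + r • Q) - r • D P Q)
      (D (P + r • Q) Q - D P Q) r := by
    intro P Q r
    have h1 : HasDerivAt (fun r : ℝ => P + r • Q) Q r := by
      simpa using ((hasDerivAt_id r).smul_const Q).const_add P
    have h2 : HasDerivAt (fun r : ℝ => r • D P Q) (D P Q) r := by
      simpa using ((hasDerivAt_id r).smul_const (D P Q))
    exact ((hd _).comp_hasDerivAt r h1).sub h2
  have key := norm_image_sub_le_of_norm_deriv_le_segment_01'
    (f := fun r : ℝ => (f (z + r • h) - r • D z h) - (f (w + r • k) - r • D w k))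
    (C := M * (‖h - k‖ + (2 * ‖z - w‖ + ‖h - k‖) * ‖k‖) * ‖h‖ + M * ‖k‖ * ‖h - k‖)
    (fun r _ => ((hline z h r).sub (hline w k r)).hasDerivWithinAt) ?_
  · simp only [one_smul, zero_smul, add_zero, sub_zero] at key
    convert key using 2
    abel
  · rintro r ⟨hr0, hr1⟩
    have e : D (z + r • h) h - D z h - (D (w + r • k) k - D w k) =
      (D (z + r • h) - D z - (D (w + r • k) - D w)) h + (D (w + r • k) - D w) (h - k) := by
      simp only [sub_apply, map_sub]; abel
    rw [e]
    have e1 : ‖D (z + r • h) - D z - (D (w + r • k) - D w)‖ ≤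
        M * (‖h - k‖ + (2 * ‖z - w‖ + ‖h - k‖) * ‖k‖) := by
      refine (hD.four _ _ _ _).trans ?_
      have q1 : z + r • h - z - (w + r • k - w) = r • (h - k) := by module
      have q2 : ‖z + r • h - (w + r • k)‖ ≤ ‖z - w‖ + ‖h - k‖ := by
        have : z + r • h - (w + r • k) = (z - w) + r • (h - k) := by module
        rw [this]
        refine (norm_add_le _ _).trans ?_
        rw [norm_smul, Real.norm_of_nonneg hr0]
        nlinarith [norm_nonneg (h - k)]
      have q3 : ‖w + r • k - w‖ ≤ ‖k‖ := by
        rw [add_sub_cancel_left, norm_smul, Real.norm_of_nonneg hr0]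
        nlinarith [norm_nonneg k]
      have q4 : ‖r • (h - k)‖ ≤ ‖h - k‖ := by
        rw [norm_smul, Real.norm_of_nonneg hr0]
        nlinarith [norm_nonneg (h - k)]
      have q5 : ‖z + r • h - (w + r • k)‖ + ‖z - w‖ ≤ 2 * ‖z - w‖ + ‖h - k‖ := by linarith
      rw [q1]
      exact mul_le_mul_of_nonneg_left (add_le_add q4
        (mul_le_mul q5 q3 (norm_nonneg _) (by positivity))) h0
    have e2 : ‖D (w + r • k) - D w‖ ≤ M * ‖k‖ := by
      refine (hD.lip _ _).trans ?_
      rw [add_sub_cancel_left, norm_smul, Real.norm_of_nonneg hr0]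
      gcongr
      nlinarith [norm_nonneg k]
    refine (norm_add_le _ _).trans ?_
    gcongr
    · exact (ContinuousLinearMap.le_opNorm _ _).trans (by gcongr)
    · exact (ContinuousLinearMap.le_opNorm _ _).trans (by gcongr)


/-- The constant in the estimate of the defect. -/
def defC (M : ℝ) : ℝ :=
  M ^ 2 * (2 * M ^ 2) ^ 2 * (4 + 2 * M ^ 2 * M) + 2 * M ^ 3 +
    M * (2 * M ^ 2) * (3 + 2 * M ^ 2 * M)

theorem g_nice {M ε : ℝ} {σ : E → U →L[ℝ] E} {Q : E → E} {a : U} (hM : 1 ≤ M) (hε : 0 ≤ ε)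
    (hεM : ε ≤ M) (hσ : Nice M σ) (hQ : Nice (M * ε ^ 2) Q) (ha : ‖a‖ ≤ M * ε) :
    Nice (2 * M ^ 2 * ε) (fun z => σ z a + Q z) := by
  refine ((hσ.eval a).add hQ).mono ?_
  have h1 : ‖a‖ * M ≤ M * ε * M := by gcongr
  have h2 : M * ε ^ 2 ≤ M * (M * ε) := by
    rw [sq]; gcongr
  nlinarith

theorem defect_est {M ε : ℝ} {σ : E → U →L[ℝ] E} {D : E → E →L[ℝ] U →L[ℝ] E} {Q1 Q2 : E → E}
    {a b : U} (hM : 1 ≤ M) (hε : 0 ≤ ε) (hεM : ε ≤ M)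
    (hd : ∀ z, HasFDerivAt σ (D z) z) (hσ : Nice M σ) (hD : Nice M D)
    (hQ1 : Nice (M * ε ^ 2) Q1) (hQ2 : Nice (M * ε ^ 2) Q2) (ha : ‖a‖ ≤ M * ε)
    (hb : ‖b‖ ≤ M * ε) (f : E → E)
    (hf : ∀ z, f z = (σ (z + (σ z a + Q1 z)) - σ z - D z (σ z a + Q1 z)) b + D z (Q1 z) b +
      (Q2 (z + (σ z a + Q1 z)) - Q2 z)) :
    (∀ z, ‖f z‖ ≤ defC M * ε ^ 3) ∧ ∀ z w, ‖f z - f w‖ ≤ defC M * ε ^ 3 * ‖z - w‖ := by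
  have hg := g_nice hM hε hεM hσ hQ1 ha
  set g : E → E := fun z => σ z a + Q1 z with hgdef
  have hf' : ∀ z, f z = (σ (z + g z) - σ z - D z (g z)) b + D z (Q1 z) b +
      (Q2 (z + g z) - Q2 z) := hf
  clear hf
  obtain ⟨N, hN⟩ : ∃ N, N = 2 * M ^ 2 := ⟨_, rfl⟩
  have hC : defC M = M ^ 2 * N ^ 2 * (4 + N * M) + 2 * M ^ 3 + M * N * (3 + N * M) := by
    rw [hN]; rfl
  rw [← hN] at hg
  have hN0 : 0 ≤ N := by rw [hN]; positivity
  have hM0 : 0 ≤ M := by linarith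
  have hNε : N * ε ≤ N * M := by gcongr
  have hNM : 0 ≤ N * M := by positivity
  clear hN
  constructor
  · intro z
    rw [hf']
    have r1 : ‖σ (z + g z) - σ z - D z (g z)‖ ≤ M * (N * ε) * (N * ε) := by
      have := remainder_lip hd hD z z (g z) 0
      simp only [add_zero, sub_self, map_zero, sub_zero, norm_zero, mul_zero, zero_mul] at this
      exact this.trans (by gcongr <;> exact hg.bdd z)
    have r2 : ‖D z (Q1 z) b‖ ≤ M * (M * ε ^ 2) * (M * ε) :=
      (ContinuousLinearMap.le_opNorm _ _).trans (by
        gcongr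
        exact (ContinuousLinearMap.le_opNorm _ _).trans (by
          gcongr
          exacts [hD.bdd z, hQ1.bdd z]))
    have r3 : ‖Q2 (z + g z) - Q2 z‖ ≤ (M * ε ^ 2) * (N * ε) :=
      (hQ2.lip _ _).trans (by
        gcongr
        rw [add_sub_cancel_left]
        exact hg.bdd z)
    have r1' : ‖(σ (z + g z) - σ z - D z (g z)) b‖ ≤ M * (N * ε) * (N * ε) * (M * ε) :=
      (ContinuousLinearMap.le_opNorm _ _).trans (by gcongr)
    refine (norm_add₃_le).trans ?_
    have : defC M * ε ^ 3 = M * (N * ε) * (N * ε) * (M * ε) + M * (M * ε ^ 2) * (M * ε) +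
      (M * ε ^ 2) * (N * ε) + (M ^ 2 * N ^ 2 * (3 + N * M) + M ^ 3 + M * N * (2 + N * M)) * ε ^ 3
      := by rw [hC]; ring
    have h3 : 0 ≤ (M ^ 2 * N ^ 2 * (3 + N * M) + M ^ 3 + M * N * (2 + N * M)) * ε ^ 3 := by
      positivity
    linarith
  · intro z w
    rw [hf', hf']
    set Δ := ‖z - w‖ with hΔ
    have hΔ0 : 0 ≤ Δ := norm_nonneg _
    have bz := hg.bdd z
    have bw := hg.bdd w
    have bzw := hg.lip z w
    have r1 : ‖(σ (z + g z) - σ z - D z (g z)) - (σ (w + g w) - σ w - D w (g w))‖ ≤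
        M * (N * ε * Δ + (2 * Δ + N * M * Δ) * (N * ε)) * (N * ε) + M * (N * ε) * (N * ε * Δ) := by
      refine (remainder_lip hd hD z w (g z) (g w)).trans ?_
      have : ‖g z - g w‖ ≤ N * M * Δ := bzw.trans (by gcongr)
      gcongr
    have r1' : ‖(σ (z + g z) - σ z - D z (g z)) b - (σ (w + g w) - σ w - D w (g w)) b‖ ≤
        (M * (N * ε * Δ + (2 * Δ + N * M * Δ) * (N * ε)) * (N * ε) +
          M * (N * ε) * (N * ε * Δ)) * (M * ε) := by
      rw [← sub_apply]
      exact (ContinuousLinearMap.le_opNorm _ _).trans (by gcongr)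
    have r2 : ‖D z (Q1 z) - D w (Q1 w)‖ ≤ (M * Δ) * (M * ε ^ 2) + M * (M * ε ^ 2 * Δ) := by
      have e : D z (Q1 z) - D w (Q1 w) = (D z - D w) (Q1 z) + D w (Q1 z - Q1 w) := by simp
      rw [e]
      refine (norm_add_le _ _).trans (add_le_add ?_ ?_)
      · exact (ContinuousLinearMap.le_opNorm _ _).trans (by
          gcongr
          exacts [hD.lip z w, hQ1.bdd z])
      · exact (ContinuousLinearMap.le_opNorm _ _).trans (by
          gcongr
          exacts [hD.bdd w, hQ1.lip z w])
    have r2' : ‖D z (Q1 z) b - D w (Q1 w) b‖ ≤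
        ((M * Δ) * (M * ε ^ 2) + M * (M * ε ^ 2 * Δ)) * (M * ε) := by
      rw [← sub_apply]
      exact (ContinuousLinearMap.le_opNorm _ _).trans (by gcongr)
    have r3 : ‖Q2 (z + g z) - Q2 z - (Q2 (w + g w) - Q2 w)‖ ≤
        (M * ε ^ 2) * (N * ε * Δ + (2 * Δ + N * M * Δ) * (N * ε)) := by
      refine (hQ2.four _ _ _ _).trans ?_
      have q1 : z + g z - z - (w + g w - w) = g z - g w := by abel
      have q2 : ‖z + g z - (w + g w)‖ ≤ Δ + N * M * Δ := by
        have : z + g z - (w + g w) = (z - w) + (g z - g w) := by abel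
        rw [this]
        exact (norm_add_le _ _).trans (add_le_add le_rfl (bzw.trans (by gcongr)))
      have q3 : w + g w - w = g w := by abel
      rw [q1, q3]
      have q4 : ‖z + g z - (w + g w)‖ + ‖z - w‖ ≤ 2 * Δ + N * M * Δ := by linarith
      exact mul_le_mul_of_nonneg_left (add_le_add bzw
        (mul_le_mul q4 bw (norm_nonneg _) (by positivity))) (by positivity)
    have e : (σ (z + g z) - σ z - D z (g z)) b + D z (Q1 z) b + (Q2 (z + g z) - Q2 z) -
        ((σ (w + g w) - σ w - D w (g w)) b + D w (Q1 w) b + (Q2 (w + g w) - Q2 w)) =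
        ((σ (z + g z) - σ z - D z (g z)) b - (σ (w + g w) - σ w - D w (g w)) b) +
        (D z (Q1 z) b - D w (Q1 w) b) + (Q2 (z + g z) - Q2 z - (Q2 (w + g w) - Q2 w)) := by
      abel
    rw [e]
    refine (norm_add₃_le).trans ?_
    refine (add_le_add (add_le_add r1' r2') r3).trans (le_of_eq ?_)
    rw [hC]; ring

end Abstract

section Flow

variable {E : Type*} [NormedAddCommGroup E] [NormedSpace ℝ E]

set_option linter.unusedSectionVars false

/-- Almost flows. -/
structure AlmostFlow (φ : ℝ → ℝ → E → E) (T L γ θ : ℝ) : Prop where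
  nice : ∀ s t, 0 ≤ s → s ≤ t → t ≤ T → Nice (L * (t - s) ^ γ) (fun z => φ s t z - z)
  defect : ∀ s u t, 0 ≤ s → s ≤ u → u ≤ t → t ≤ T → ∀ z,
    ‖φ u t (φ s u z) - φ s t z‖ ≤ L * (t - s) ^ θ
  defect_lip : ∀ s u t, 0 ≤ s → s ≤ u → u ≤ t → t ≤ T → ∀ z w,
    ‖φ u t (φ s u z) - φ s t z - (φ u t (φ s u w) - φ s t w)‖ ≤ L * (t - s) ^ θ * ‖z - w‖

/-- Composition of `n` consecutive maps, starting from the `k`-th. -/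
def cmpN (f : ℕ → E → E) : ℕ → ℕ → E → E
  | _, 0, z => z
  | k, n + 1, z => cmpN f (k + 1) n (f k z)

theorem cmpN_add (f : ℕ → E → E) (p q k : ℕ) (z : E) :
    cmpN f k (p + q) z = cmpN f (k + p) q (cmpN f k p z) := by
  induction p generalizing k z with
  | zero => simp [cmpN]
  | succ p ih =>
    rw [show p + 1 + q = (p + q) + 1 by ring]
    simp only [cmpN]
    rw [ih, show k + 1 + p = k + (p + 1) by ring]

/-- One step of the scheme with mesh `h` started at `r`. -/
def stp (φ : ℝ → ℝ → E → E) (r h : ℝ) (k : ℕ) : E → E := φ (r + k * h) (r + (k + 1 : ℕ) * h)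

theorem split_pow {θ P Q S : ℝ} (hθ : 1 < θ) (hP : 0 ≤ P) (hQ : 0 ≤ Q) (hS : P + Q = S)
    (hP2 : P ≤ 2 / 3 * S) (hQ2 : Q ≤ 2 / 3 * S) :
    P ^ θ + Q ^ θ ≤ (2 / 3 : ℝ) ^ (θ - 1) * S ^ θ := by
  have hS0 : 0 ≤ S := by linarith
  have key : ∀ R : ℝ, 0 ≤ R → R ≤ 2 / 3 * S → R ^ θ ≤ R * ((2 / 3 : ℝ) ^ (θ - 1) * S ^ (θ - 1)) := by
    intro R hR hRS
    have e : R ^ θ = R * R ^ (θ - 1) := by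
      rw [← Real.rpow_one_add' hR (by linarith)]; congr 1; ring
    rw [e, ← Real.mul_rpow (by norm_num) hS0]
    gcongr
  have e : S ^ θ = S * S ^ (θ - 1) := by
    rw [← Real.rpow_one_add' hS0 (by linarith)]; congr 1; ring
  have := key P hP hP2
  have := key Q hQ hQ2
  rw [e]
  calc _ ≤ (P + Q) * ((2 / 3 : ℝ) ^ (θ - 1) * S ^ (θ - 1)) := by linarith
    _ = _ := by rw [hS]; ring

/-- Plain inductive step. -/
theorem step_plain {Φ1 Φ2 φ1 φ2 φ3 : E → E} {K K2 L η p q s ρ : ℝ} (hη : 0 ≤ η)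
    (hK : 0 ≤ K) (hp : 0 ≤ p) (hq : 0 ≤ q) (hs : 0 ≤ s)
    (hpq : p + q ≤ ρ * s) (hKL : (1 + η) * ρ * K + L ≤ K)
    (h1 : ∀ z, ‖Φ1 z - φ1 z‖ ≤ K * p) (h2 : ∀ z, ‖Φ2 z - φ2 z‖ ≤ K * q)
    (hn : Nice η (fun z => φ2 z - z)) (hd : ∀ z, ‖φ2 (φ1 z) - φ3 z‖ ≤ L * s) (z : E) :
    ‖Φ2 (Φ1 z) - φ3 z‖ ≤ K * s := by
  have e : Φ2 (Φ1 z) - φ3 z = (Φ2 (Φ1 z) - φ2 (Φ1 z)) + ((φ2 (Φ1 z) - Φ1 z) - (φ2 (φ1 z) - φ1 z))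
    + (Φ1 z - φ1 z) + (φ2 (φ1 z) - φ3 z) := by abel
  rw [e]
  refine norm_add₄_le.trans ?_
  have a1 := h2 (Φ1 z)
  have a2 := hn.lip (Φ1 z) (φ1 z)
  have a3 := h1 z
  have a4 := hd z
  have a5 : η * ‖Φ1 z - φ1 z‖ ≤ η * (K * p) := by gcongr
  have a6 : (1 + η) * K * (p + q) ≤ (1 + η) * K * (ρ * s) := by gcongr
  have a7 : ((1 + η) * ρ * K + L) * s ≤ K * s := by gcongr
  have a8 : 0 ≤ η * K * q := by positivity
  nlinarith

/-- Lipschitz inductive step. -/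
theorem step_lip {Φ1 Φ2 φ1 φ2 φ3 : E → E} {K K' L η p q s ρ : ℝ} (hη : 0 ≤ η) (hη1 : η ≤ 1)
    (hK : 0 ≤ K) (hK' : 0 ≤ K') (hp : 0 ≤ p) (hq : 0 ≤ q) (hs : 0 ≤ s) (hps : p ≤ s)
    (hK's : K' * s ≤ η)
    (hpq : p + q ≤ ρ * s) (hKL : (1 + 2 * η) * ρ * K' + 5 * K + L ≤ K')
    (h1 : ∀ z, ‖Φ1 z - φ1 z‖ ≤ K * p)
    (h1' : ∀ z w, ‖Φ1 z - φ1 z - (Φ1 w - φ1 w)‖ ≤ K' * p * ‖z - w‖)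
    (h2' : ∀ z w, ‖Φ2 z - φ2 z - (Φ2 w - φ2 w)‖ ≤ K' * q * ‖z - w‖)
    (hn1 : Nice η (fun z => φ1 z - z))
    (hn : Nice η (fun z => φ2 z - z))
    (hd : ∀ z w, ‖φ2 (φ1 z) - φ3 z - (φ2 (φ1 w) - φ3 w)‖ ≤ L * s * ‖z - w‖) (z w : E) :
    ‖Φ2 (Φ1 z) - φ3 z - (Φ2 (Φ1 w) - φ3 w)‖ ≤ K' * s * ‖z - w‖ := by
  set Δ := ‖z - w‖ with hΔ
  have hΔ0 : 0 ≤ Δ := norm_nonneg _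
  have b1 : ‖φ1 z - φ1 w‖ ≤ (1 + η) * Δ := by
    have e : φ1 z - φ1 w = (z - w) + ((φ1 z - z) - (φ1 w - w)) := by abel
    rw [e]
    refine (norm_add_le _ _).trans ?_
    have := hn1.lip z w
    linarith
  have b2 : ‖Φ1 z - Φ1 w‖ ≤ (1 + 2 * η) * Δ := by
    have e : Φ1 z - Φ1 w = (φ1 z - φ1 w) + (Φ1 z - φ1 z - (Φ1 w - φ1 w)) := by abel
    rw [e]
    refine (norm_add_le _ _).trans ?_
    have c1 := h1' z w
    have c2 : K' * p * Δ ≤ η * Δ := by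
      gcongr
      exact le_trans (by gcongr) hK's
    linarith
  have e : Φ2 (Φ1 z) - φ3 z - (Φ2 (Φ1 w) - φ3 w) =
      (Φ2 (Φ1 z) - φ2 (Φ1 z) - (Φ2 (Φ1 w) - φ2 (Φ1 w)))
      + (((φ2 (Φ1 z) - Φ1 z) - (φ2 (φ1 z) - φ1 z)) - ((φ2 (Φ1 w) - Φ1 w) - (φ2 (φ1 w) - φ1 w)))
      + (Φ1 z - φ1 z - (Φ1 w - φ1 w)) + (φ2 (φ1 z) - φ3 z - (φ2 (φ1 w) - φ3 w)) := by abel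
  rw [e]
  refine norm_add₄_le.trans ?_
  have a1 : ‖Φ2 (Φ1 z) - φ2 (Φ1 z) - (Φ2 (Φ1 w) - φ2 (Φ1 w))‖ ≤ K' * q * ((1 + 2 * η) * Δ) :=
    (h2' _ _).trans (by gcongr)
  have a2 := hn.four (Φ1 z) (φ1 z) (Φ1 w) (φ1 w)
  have a3 : η * (‖Φ1 z - φ1 z - (Φ1 w - φ1 w)‖ + (‖Φ1 z - Φ1 w‖ + ‖φ1 z - φ1 w‖) *
      ‖Φ1 w - φ1 w‖) ≤ η * (K' * p * Δ + ((1 + 2 * η) * Δ + (1 + η) * Δ) * (K * p)) := by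
    gcongr
    exacts [h1' z w, h1 w]
  have a4 := h1' z w
  have a5 := hd z w
  have a6 : (1 + 2 * η) * K' * Δ * (p + q) ≤ (1 + 2 * η) * K' * Δ * (ρ * s) := by gcongr
  have a7 : ((1 + 2 * η) * ρ * K' + 5 * K + L) * (s * Δ) ≤ K' * (s * Δ) := by gcongr
  have a8 : η * (((1 + 2 * η) * Δ + (1 + η) * Δ) * (K * p)) ≤ 5 * K * (s * Δ) := by
    calc η * (((1 + 2 * η) * Δ + (1 + η) * Δ) * (K * p))
        ≤ 1 * (((1 + 2 * 1) * Δ + (1 + 1) * Δ) * (K * s)) := by gcongr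
      _ = _ := by ring
  have a9 : 0 ≤ η * K' * p * Δ := by positivity
  nlinarith

theorem AlmostFlow.discrete {φ : ℝ → ℝ → E → E} {T L γ θ : ℝ} (hφ : AlmostFlow φ T L γ θ)
    (hL : 0 ≤ L) (hγ : 0 < γ) (hθ : 1 < θ) :
    ∃ δ K : ℝ, 0 < δ ∧ 0 ≤ K ∧ ∀ r h : ℝ, 0 ≤ r → 0 ≤ h → ∀ n k : ℕ, r + (k + n : ℕ) * h ≤ T →
      n * h ≤ δ →
      (∀ z, ‖cmpN (stp φ r h) k n z - φ (r + k * h) (r + (k + n : ℕ) * h) z‖ ≤ K * (n * h) ^ θ) ∧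
      (∀ z w, ‖cmpN (stp φ r h) k n z - cmpN (stp φ r h) k n w‖ ≤ 3 * ‖z - w‖) := by
  obtain ⟨ρ, hρ⟩ : ∃ ρ : ℝ, ρ = (2 / 3 : ℝ) ^ (θ - 1) := ⟨_, rfl⟩
  have hρ0 : 0 < ρ := by rw [hρ]; positivity
  have hρ1 : ρ < 1 := by
    rw [hρ]; exact Real.rpow_lt_one (by norm_num) (by norm_num) (by linarith)
  obtain ⟨η, hη⟩ : ∃ η : ℝ, η = (1 - ρ) / 4 := ⟨_, rfl⟩
  have hη0 : 0 < η := by rw [hη]; linarith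
  have hη1 : η ≤ 1 := by rw [hη]; linarith
  obtain ⟨K, hK⟩ : ∃ K : ℝ, K = 2 * L / (1 - ρ) := ⟨_, rfl⟩
  obtain ⟨K', hK'⟩ : ∃ K' : ℝ, K' = 2 * (5 * K + L) / (1 - ρ) := ⟨_, rfl⟩
  have h1ρ : 0 < 1 - ρ := by linarith
  have hK0 : 0 ≤ K := by rw [hK]; positivity
  have hK'0 : 0 ≤ K' := by rw [hK']; positivity
  have hKe : K * (1 - ρ) = 2 * L := by rw [hK]; field_simp
  have hKe' : K' * (1 - ρ) = 2 * (5 * K + L) := by rw [hK']; field_simp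
  have hc : (1 + 2 * η) * ρ ≤ (1 + ρ) / 2 := by rw [hη]; nlinarith
  have hc' : (1 + η) * ρ ≤ (1 + ρ) / 2 := by nlinarith
  have hKL : (1 + η) * ρ * K + L ≤ K := by nlinarith
  have hKL' : (1 + 2 * η) * ρ * K' + 5 * K + L ≤ K' := by nlinarith
  obtain ⟨δ, hδ0, hδ1, hδ2⟩ : ∃ δ : ℝ, 0 < δ ∧ L * δ ^ γ ≤ η ∧ K' * δ ^ θ ≤ η := by
    have t1 : Filter.Tendsto (fun δ : ℝ => L * δ ^ γ) (nhdsWithin 0 (Ioi 0)) (nhds 0) := by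
      have : ContinuousAt (fun δ : ℝ => L * δ ^ γ) 0 :=
        (Real.continuousAt_rpow_const _ _ (Or.inr hγ.le)).const_mul L
      have h := this.tendsto
      simp only [Real.zero_rpow hγ.ne', mul_zero] at h
      exact h.mono_left nhdsWithin_le_nhds
    have t2 : Filter.Tendsto (fun δ : ℝ => K' * δ ^ θ) (nhdsWithin 0 (Ioi 0)) (nhds 0) := by
      have : ContinuousAt (fun δ : ℝ => K' * δ ^ θ) 0 :=
        (Real.continuousAt_rpow_const _ _ (Or.inr (by linarith))).const_mul K'
      have h := this.tendsto
      simp only [Real.zero_rpow (show θ ≠ 0 by linarith), mul_zero] at h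
      exact h.mono_left nhdsWithin_le_nhds
    obtain ⟨δ, h1, h2, h3⟩ := ((t1.eventually (ge_mem_nhds hη0)).and
      ((t2.eventually (ge_mem_nhds hη0)).and self_mem_nhdsWithin)).exists
    exact ⟨δ, h3, h1, h2⟩
  have hnice : ∀ s t, 0 ≤ s → s ≤ t → t ≤ T → t - s ≤ δ → Nice η (fun z => φ s t z - z) := by
    intro s t hs hst ht hd
    refine (hφ.nice s t hs hst ht).mono (le_trans ?_ hδ1)
    have : 0 ≤ t - s := by linarith
    gcongr
  refine ⟨δ, K, hδ0, hK0, fun r h hr hh => ?_⟩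
  have main : ∀ n k : ℕ, r + (k + n : ℕ) * h ≤ T → n * h ≤ δ →
      (∀ z, ‖cmpN (stp φ r h) k n z - φ (r + k * h) (r + (k + n : ℕ) * h) z‖ ≤ K * (n * h) ^ θ) ∧
      (∀ z w, ‖cmpN (stp φ r h) k n z - φ (r + k * h) (r + (k + n : ℕ) * h) z -
        (cmpN (stp φ r h) k n w - φ (r + k * h) (r + (k + n : ℕ) * h) w)‖ ≤
          K' * (n * h) ^ θ * ‖z - w‖) := by
    intro n
    induction n using Nat.strong_induction_on with
    | _ n ih =>
      intro k hT hδ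
      have hs0 : 0 ≤ r + k * h := by positivity
      rcases Nat.lt_or_ge n 2 with hn | hn
      · have hz : ∀ z, cmpN (stp φ r h) k n z - φ (r + k * h) (r + (k + n : ℕ) * h) z = 0 := by
          intro z
          interval_cases n
          · have := (hφ.nice (r + k * h) (r + k * h) hs0 le_rfl (by simpa using hT)).bdd z
            rw [sub_self, Real.zero_rpow hγ.ne', mul_zero] at this
            have := norm_le_zero_iff.1 this
            rw [sub_eq_zero] at this
            simp [cmpN, this]
          · simp [cmpN, stp]
        constructor
        · intro z; rw [hz]; simp; positivity
        · intro z w; rw [hz, hz]; simp; positivity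
      · obtain ⟨p, q, hpq, hp1, hq1, hp2, hq2⟩ : ∃ p q : ℕ, p + q = n ∧ 1 ≤ p ∧ 1 ≤ q ∧
            3 * p ≤ 2 * n ∧ 3 * q ≤ 2 * n := ⟨n / 2, n - n / 2, by omega, by omega, by omega,
              by omega, by omega⟩
        have hp2' : (p : ℝ) * 3 ≤ 2 * n := by exact_mod_cast (by omega : p * 3 ≤ 2 * n)
        have hq2' : (q : ℝ) * 3 ≤ 2 * n := by exact_mod_cast (by omega : q * 3 ≤ 2 * n)
        have hpqr : (p : ℝ) + q = n := by exact_mod_cast hpq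
        have hsum : (p * h : ℝ) + q * h = n * h := by rw [← hpqr]; ring
        have hph : 0 ≤ (p : ℝ) * h := by positivity
        have hqh : 0 ≤ (q : ℝ) * h := by positivity
        have hk2 : (k + p) + q = k + n := by omega
        have hsp : ((p : ℝ) * h) ^ θ + (q * h) ^ θ ≤ ρ * (n * h) ^ θ := by
          rw [hρ]
          refine split_pow hθ hph hqh hsum ?_ ?_ <;> nlinarith
        have hmid : r + (k + p : ℕ) * h + q * h = r + (k + n : ℕ) * h := by
          rw [← hk2]; push_cast; ring
        have hmid1 : r + k * h + p * h = r + (k + p : ℕ) * h := by push_cast; ring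
        have i1 := ih p (by omega) k (by linarith) (by linarith)
        have i2 := ih q (by omega) (k + p) (by rw [hk2]; exact hT) (by linarith)
        rw [hk2] at i2
        have hcm : ∀ z, cmpN (stp φ r h) k n z =
            cmpN (stp φ r h) (k + p) q (cmpN (stp φ r h) k p z) := by
          intro z; rw [← cmpN_add, hpq]
        have hnh : r + (k + n : ℕ) * h - (r + k * h) = n * h := by push_cast; ring
        have n1 := hnice (r + k * h) (r + (k + p : ℕ) * h) hs0 (by linarith) (by linarith)
          (by linarith)
        have n2 := hnice (r + (k + p : ℕ) * h) (r + (k + n : ℕ) * h) (by linarith) (by linarith) hT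
          (by linarith)
        have d1 := hφ.defect (r + k * h) (r + (k + p : ℕ) * h) (r + (k + n : ℕ) * h) hs0
          (by linarith) (by linarith) hT
        have d2 := hφ.defect_lip (r + k * h) (r + (k + p : ℕ) * h) (r + (k + n : ℕ) * h) hs0
          (by linarith) (by linarith) hT
        rw [hnh] at d1 d2
        have hnh0 : 0 ≤ (n : ℝ) * h := by positivity
        constructor
        · intro z
          rw [hcm]
          exact step_plain (K2 := 0) hη0.le hK0 (by positivity) (by positivity) (by positivity)
            hsp hKL i1.1 i2.1 n2 d1 z
        · intro z w
          rw [hcm, hcm]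
          refine step_lip hη0.le hη1 hK0 hK'0 (by positivity) (by positivity) (by positivity)
            ?_ ?_ hsp hKL' i1.1 i1.2 i2.2 n1 n2 d2 z w
          · gcongr; linarith
          · exact le_trans (by gcongr) hδ2
  intro n k hT hδ
  refine ⟨(main n k hT hδ).1, fun z w => ?_⟩
  have c1 := (main n k hT hδ).2 z w
  have hnh : r + (k + n : ℕ) * h - (r + k * h) = n * h := by push_cast; ring
  have hnh0 : 0 ≤ (n : ℝ) * h := by positivity
  have c2 := (hnice (r + k * h) (r + (k + n : ℕ) * h) (by positivity) (by linarith) hT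
    (by linarith)).lip z w
  have c3 : K' * (n * h) ^ θ * ‖z - w‖ ≤ 1 * ‖z - w‖ := by
    gcongr
    exact le_trans (by gcongr) (hδ2.trans hη1)
  have c4 : η * ‖z - w‖ ≤ 1 * ‖z - w‖ := by gcongr
  set A := cmpN (stp φ r h) k n
  set B := φ (r + k * h) (r + (k + n : ℕ) * h)
  have e : A z - A w = (A z - B z - (A w - B w)) + (B z - z - (B w - w)) + (z - w) := by abel
  rw [e]
  refine norm_add₃_le.trans ?_
  linarith

/-- Local uniqueness. -/
theorem euler_compare {φ : ℝ → ℝ → E → E} {T θ C r t : ℝ} (hC : 0 ≤ C)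
    (hr : 0 ≤ r) (hrt : r ≤ t) (ht : t ≤ T) {y : ℝ → E}
    (hy : ∀ s t, 0 ≤ s → s ≤ t → t ≤ T → ‖y t - φ s t (y s)‖ ≤ C * (t - s) ^ θ) (n : ℕ)
    (h : ℝ) (hh : n * h = t - r) (hh0 : 0 ≤ h)
    (hlip : ∀ k j : ℕ, k + j ≤ n → ∀ z w,
      ‖cmpN (stp φ r h) k j z - cmpN (stp φ r h) k j w‖ ≤ 3 * ‖z - w‖) :
    ‖y t - cmpN (stp φ r h) 0 n (y r)‖ ≤ n * (3 * (C * h ^ θ)) := by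
  have key : ∀ j k : ℕ, k + j = n →
      ‖y t - cmpN (stp φ r h) k j (y (r + k * h))‖ ≤ j * (3 * (C * h ^ θ)) := by
    intro j
    induction j with
    | zero =>
      intro k hk
      have : r + k * h = t := by
        have : k = n := by omega
        rw [this]; linarith
      simp [cmpN, this]
    | succ j ih =>
      intro k hk
      have i := ih (k + 1) (by omega)
      simp only [cmpN]
      have l := hlip (k + 1) j (by omega) (y (r + (k + 1 : ℕ) * h)) (stp φ r h k (y (r + k * h)))
      have hkn : ((k + 1 : ℕ) : ℝ) * h ≤ n * h := by
        gcongr; omega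
      have s := hy (r + k * h) (r + (k + 1 : ℕ) * h) (by positivity) (by gcongr; omega)
        (by linarith)
      have e : r + (k + 1 : ℕ) * h - (r + k * h) = h := by push_cast; ring
      rw [e] at s
      have e2 : y t - cmpN (stp φ r h) (k + 1) j (stp φ r h k (y (r + k * h))) =
        (y t - cmpN (stp φ r h) (k + 1) j (y (r + (k + 1 : ℕ) * h))) +
        (cmpN (stp φ r h) (k + 1) j (y (r + (k + 1 : ℕ) * h)) -
          cmpN (stp φ r h) (k + 1) j (stp φ r h k (y (r + k * h)))) := by abel
      rw [e2]
      refine (norm_add_le _ _).trans ?_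
      have : ‖y (r + (k + 1 : ℕ) * h) - stp φ r h k (y (r + k * h))‖ ≤ C * h ^ θ := s
      push_cast
      push_cast at i l this
      nlinarith
  simpa using key n 0 (by simp)

theorem AlmostFlow.unique {φ : ℝ → ℝ → E → E} {T L γ θ θ' C C' : ℝ} (hφ : AlmostFlow φ T L γ θ)
    (hL : 0 ≤ L) (hγ : 0 < γ) (hθ : 1 < θ) (hθ' : 1 < θ') {y y' : ℝ → E}
    (hy : ∀ s t, 0 ≤ s → s ≤ t → t ≤ T → ‖y t - φ s t (y s)‖ ≤ C * (t - s) ^ θ')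
    (hy' : ∀ s t, 0 ≤ s → s ≤ t → t ≤ T → ‖y' t - φ s t (y' s)‖ ≤ C' * (t - s) ^ θ')
    (h0 : y 0 = y' 0) : ∀ t, 0 ≤ t → t ≤ T → y t = y' t := by
  obtain ⟨δ, K, hδ, hK, H⟩ := hφ.discrete hL hγ hθ
  obtain ⟨B, hB0, hBC, hBC'⟩ : ∃ B : ℝ, 0 ≤ B ∧ C ≤ B ∧ C' ≤ B :=
    ⟨max 0 (max C C'), by simp, by simp, by simp⟩
  have hyB : ∀ s t, 0 ≤ s → s ≤ t → t ≤ T → ‖y t - φ s t (y s)‖ ≤ B * (t - s) ^ θ' := by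
    intro s t hs hst ht
    have : 0 ≤ t - s := by linarith
    exact (hy s t hs hst ht).trans (by gcongr)
  have hyB' : ∀ s t, 0 ≤ s → s ≤ t → t ≤ T → ‖y' t - φ s t (y' s)‖ ≤ B * (t - s) ^ θ' := by
    intro s t hs hst ht
    have : 0 ≤ t - s := by linarith
    exact (hy' s t hs hst ht).trans (by gcongr)
  have loc : ∀ r t, 0 ≤ r → r ≤ t → t ≤ T → t - r ≤ δ → y r = y' r → y t = y' t := by
    intro r t hr hrt ht htr hyr
    have hb : ∀ n : ℕ, ‖y t - y' t‖ ≤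
        6 * B * (t - r) ^ θ' * ((n + 1 : ℕ) : ℝ) ^ (-(θ' - 1)) := by
      intro n
      obtain ⟨N, hN⟩ : ∃ N : ℕ, N = n + 1 := ⟨_, rfl⟩
      rw [← hN]
      have hN0 : (0 : ℝ) < N := by rw [hN]; positivity
      have htr0 : 0 ≤ t - r := by linarith
      obtain ⟨h, hh⟩ : ∃ h : ℝ, h = (t - r) / N := ⟨_, rfl⟩
      have hNh : N * h = t - r := by rw [hh]; field_simp
      have hh0 : 0 ≤ h := by rw [hh]; positivity
      have hlip : ∀ k j : ℕ, k + j ≤ N → ∀ z w,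
          ‖cmpN (stp φ r h) k j z - cmpN (stp φ r h) k j w‖ ≤ 3 * ‖z - w‖ := by
        intro k j hkj
        have e1 : ((k + j : ℕ) : ℝ) * h ≤ N * h := by gcongr
        have e2 : (j : ℝ) * h ≤ N * h := by gcongr; omega
        exact (H r h hr hh0 j k (by linarith) (by linarith)).2
      have c1 := euler_compare hB0 hr hrt ht hyB N h hNh hh0 hlip
      have c2 := euler_compare hB0 hr hrt ht hyB' N h hNh hh0 hlip
      rw [← hyr] at c2
      have e : y t - y' t = (y t - cmpN (stp φ r h) 0 N (y r)) -
        (y' t - cmpN (stp φ r h) 0 N (y r)) := by abel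
      rw [e]
      refine (norm_sub_le _ _).trans ((add_le_add c1 c2).trans (le_of_eq ?_))
      rw [hh, Real.div_rpow htr0 hN0.le, Real.rpow_neg hN0.le, Real.rpow_sub hN0, Real.rpow_one]
      field_simp
      ring
    have lim : Filter.Tendsto (fun n : ℕ => 6 * B * (t - r) ^ θ' * ((n + 1 : ℕ) : ℝ) ^ (-(θ' - 1)))
        Filter.atTop (nhds 0) := by
      have := (tendsto_rpow_neg_atTop (show 0 < θ' - 1 by linarith)).comp
        (tendsto_natCast_atTop_atTop.comp (Filter.tendsto_add_atTop_nat 1))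
      simpa using this.const_mul (6 * B * (t - r) ^ θ')
    have := ge_of_tendsto' lim hb
    exact sub_eq_zero.1 (norm_le_zero_iff.1 this)
  have ind : ∀ n : ℕ, ∀ t, 0 ≤ t → t ≤ T → t ≤ n * δ → y t = y' t := by
    intro n
    induction n with
    | zero =>
      intro t h1 h2 h3
      have : t = 0 := by simp at h3; linarith
      rw [this, h0]
    | succ n ih =>
      intro t h1 h2 h3
      push_cast at h3
      by_cases hc : t ≤ n * δ
      · exact ih t h1 h2 hc
      · push Not at hc
        have : 0 ≤ (n : ℝ) * δ := by positivity
        exact loc (n * δ) t this hc.le h2 (by linarith) (ih _ this (by linarith) le_rfl)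
  intro t h1 h2
  obtain ⟨n, hn⟩ := exists_nat_ge (t / δ)
  exact ind n t h1 h2 (by rwa [div_le_iff₀ hδ] at hn)

end Flow

section Existence

variable {E : Type*} [NormedAddCommGroup E] [NormedSpace ℝ E]

open Filter Topology

theorem disc_bound {T δ h B1 : ℝ} (hδ : 0 < δ) (hh : 0 < h) (hhδ : h ≤ δ / 2) (hB1 : 0 ≤ B1)
    (Y : ℕ → E)
    (hY : ∀ k j : ℕ, (k + j : ℕ) * h ≤ T → j * h ≤ δ → ‖Y (k + j) - Y k‖ ≤ B1) (k : ℕ)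
    (hk : k * h ≤ T) : ‖Y k - Y 0‖ ≤ B1 * (1 + 2 * (k * h) / δ) := by
  have hf := Nat.floor_le (show 0 ≤ δ / h by positivity)
  have hf2 := Nat.lt_floor_add_one (δ / h)
  set p := ⌊δ / h⌋₊ with hp
  rw [le_div_iff₀ hh] at hf
  rw [div_lt_iff₀ hh] at hf2
  have hph : δ / 2 ≤ p * h := by linarith
  have hp1 : 0 < p := by
    rcases Nat.eq_zero_or_pos p with h0 | h0
    · rw [h0] at hph; simp at hph; linarith
    · exact h0
  induction k using Nat.strong_induction_on with
  | _ k ih =>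
    rcases Nat.lt_or_ge k p with hkp | hkp
    · have h1 : (k : ℝ) * h ≤ p * h := by gcongr
      have := hY 0 k (by simpa using hk) (by linarith)
      rw [zero_add] at this
      refine this.trans ?_
      have : 0 ≤ 2 * (k * h) / δ := by positivity
      nlinarith
    · obtain ⟨q, rfl⟩ := Nat.exists_eq_add_of_le' hkp
      have e1 : ((q + p : ℕ) : ℝ) * h = q * h + p * h := by push_cast; ring
      have i := ih q (by omega) (by linarith)
      have j := hY q p hk hf
      have e : Y (q + p) - Y 0 = (Y (q + p) - Y q) + (Y q - Y 0) := by abel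
      rw [e]
      refine (norm_add_le _ _).trans ((add_le_add j i).trans ?_)
      rw [e1]
      have : 2 * (q * h + p * h) / δ ≥ 2 * (q * h) / δ + 1 := by
        rw [ge_iff_le, ← sub_nonneg]
        have : 2 * (q * h + p * h) / δ - (2 * (q * h) / δ + 1) = (2 * (p * h) - δ) / δ := by
          field_simp; ring
        rw [this]
        apply div_nonneg _ hδ.le
        linarith
      nlinarith

theorem AlmostFlow.exists_sol [ProperSpace E] {φ : ℝ → ℝ → E → E} {T L γ θ : ℝ}
    (hφ : AlmostFlow φ T L γ θ) (hL : 0 ≤ L) (hγ : 0 < γ) (hθ : 1 < θ) (hT : 0 < T)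
    (hcont : ContinuousOn (fun p : ℝ × ℝ × E => φ p.1 p.2.1 p.2.2)
      {p | 0 ≤ p.1 ∧ p.1 ≤ p.2.1 ∧ p.2.1 ≤ T}) (a : E) :
    ∃ (y : ℝ → E) (C : ℝ), 0 ≤ C ∧ ContinuousOn y (Icc 0 T) ∧ y 0 = a ∧
      ∀ s t, 0 ≤ s → s ≤ t → t ≤ T → ‖y t - φ s t (y s)‖ ≤ C * (t - s) ^ θ := by
  obtain ⟨δ, K, hδ, hK, H⟩ := hφ.discrete hL hγ hθ
  let h : ℕ → ℝ := fun n => T / (n + 1 : ℕ)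
  have hh0 : ∀ n, 0 < h n := fun n => by positivity
  have hhT : Tendsto h atTop (𝓝 0) := by
    have := (tendsto_const_div_atTop_nhds_zero_nat T).comp (tendsto_add_atTop_nat 1)
    exact this
  let Y : ℕ → ℕ → E := fun n k => cmpN (stp φ 0 (h n)) 0 k a
  have hYs : ∀ n k j, Y n (k + j) = cmpN (stp φ 0 (h n)) k j (Y n k) := by
    intro n k j
    simp only [Y]
    rw [cmpN_add, zero_add]
  have hY1 : ∀ n k j : ℕ, (k + j : ℕ) * h n ≤ T → j * h n ≤ δ →
      ‖Y n (k + j) - φ (k * h n) ((k + j : ℕ) * h n) (Y n k)‖ ≤ K * (j * h n) ^ θ := by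
    intro n k j h1 h2
    have := (H 0 (h n) le_rfl (hh0 n).le j k (by linarith) h2).1 (Y n k)
    rw [← hYs, zero_add, zero_add] at this
    exact this
  obtain ⟨B1, hB1⟩ : ∃ B1, B1 = K * δ ^ θ + L * δ ^ γ := ⟨_, rfl⟩
  have hB10 : 0 ≤ B1 := by rw [hB1]; positivity
  have hY2 : ∀ n k j : ℕ, (k + j : ℕ) * h n ≤ T → j * h n ≤ δ →
      ‖Y n (k + j) - Y n k‖ ≤ B1 := by
    intro n k j h1 h2
    have c1 := hY1 n k j h1 h2
    have hh := hh0 n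
    have e : ((k + j : ℕ) : ℝ) * h n - k * h n = j * h n := by push_cast; ring
    have hj0 : 0 ≤ (j : ℝ) * h n := by positivity
    have c2 := (hφ.nice (k * h n) ((k + j : ℕ) * h n) (by positivity) (by linarith) h1).bdd (Y n k)
    rw [e] at c2
    have e2 : Y n (k + j) - Y n k = (Y n (k + j) - φ (k * h n) ((k + j : ℕ) * h n) (Y n k)) +
      (φ (k * h n) ((k + j : ℕ) * h n) (Y n k) - Y n k) := by abel
    rw [e2, hB1]
    refine (norm_add_le _ _).trans (add_le_add (c1.trans ?_) (c2.trans ?_)) <;> gcongr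
  obtain ⟨B, hB⟩ : ∃ B, B = B1 * (1 + 2 * T / δ) := ⟨_, rfl⟩
  have hB0 : 0 ≤ B := by rw [hB]; positivity
  have hbd : ∀ᶠ n in atTop, ∀ k : ℕ, k * h n ≤ T → ‖Y n k - a‖ ≤ B := by
    filter_upwards [hhT.eventually (ge_mem_nhds (show 0 < δ / 2 by positivity))] with n hn k hk
    have := disc_bound hδ (hh0 n) hn hB10 (Y n) (hY2 n) k hk
    refine this.trans ?_
    rw [hB]
    gcongr
  let kk : ℕ → ℝ → ℕ := fun n t => ⌊t / h n⌋₊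
  have hkk1 : ∀ n t, 0 ≤ t → kk n t * h n ≤ t := by
    intro n t ht
    have := Nat.floor_le (show 0 ≤ t / h n from div_nonneg ht (hh0 n).le)
    rwa [le_div_iff₀ (hh0 n)] at this
  have hkk2 : ∀ n t, t - h n ≤ kk n t * h n := by
    intro n t
    have := Nat.lt_floor_add_one (t / h n)
    rw [div_lt_iff₀ (hh0 n)] at this
    simp only [kk]
    linarith
  have hkkt : ∀ t, 0 ≤ t → Tendsto (fun n => (kk n t : ℝ) * h n) atTop (𝓝 t) := by
    intro t ht
    refine tendsto_of_tendsto_of_tendsto_of_le_of_le (g := fun n => t - h n) (h := fun _ => t) ?_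
      tendsto_const_nhds (fun n => hkk2 n t) (fun n => hkk1 n t ht)
    simpa using hhT.const_sub t
  let U : Ultrafilter ℕ := hyperfilter ℕ
  have hU : (U : Filter ℕ) ≤ atTop := by
    rw [← Nat.cofinite_eq_atTop]; exact hyperfilter_le_cofinite
  have hex : ∀ t, ∃ z : E, 0 ≤ t → t ≤ T →
      Tendsto (fun n => Y n (kk n t)) U (𝓝 z) ∧ ‖z - a‖ ≤ B := by
    intro t
    by_cases ht : 0 ≤ t ∧ t ≤ T
    · have hmem : Metric.closedBall a B ∈ U.map (fun n => Y n (kk n t)) := by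
        rw [Ultrafilter.mem_map]
        have : ∀ᶠ n in (U : Filter ℕ), Y n (kk n t) ∈ Metric.closedBall a B := by
          filter_upwards [hU hbd] with n hn
          rw [mem_closedBall_iff_norm]
          exact hn _ ((hkk1 n t ht.1).trans ht.2)
        exact this
      obtain ⟨z, hz, hz2⟩ := (isCompact_closedBall a B).ultrafilter_le_nhds' _ hmem
      exact ⟨z, fun _ _ => ⟨hz2, by rwa [mem_closedBall_iff_norm] at hz⟩⟩
    · exact ⟨0, fun h1 h2 => absurd ⟨h1, h2⟩ ht⟩
  choose y hy using hex
  have hloc : ∀ s t, 0 ≤ s → s ≤ t → t ≤ T → t - s < δ →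
      ‖y t - φ s t (y s)‖ ≤ K * (t - s) ^ θ := by
    intro s t hs hst ht hd
    have ts := (hkkt s hs).mono_left hU
    have tt := (hkkt t (hs.trans hst)).mono_left hU
    have ys := (hy s hs (hst.trans ht)).1
    have yt := (hy t (hs.trans hst) ht).1
    have hmono : ∀ n, kk n s ≤ kk n t := by
      intro n
      have := (hh0 n).le
      exact Nat.floor_mono (by gcongr)
    have tφ : Tendsto (fun n => φ (kk n s * h n) (kk n t * h n) (Y n (kk n s))) U
        (𝓝 (φ s t (y s))) := by
      have h1 := (hcont (s, t, y s) ⟨hs, hst, ht⟩).tendsto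
      have h2 : Tendsto (fun n => ((kk n s * h n, kk n t * h n, Y n (kk n s)) : ℝ × ℝ × E)) U
          (𝓝[{p | 0 ≤ p.1 ∧ p.1 ≤ p.2.1 ∧ p.2.1 ≤ T}] (s, t, y s)) := by
        refine tendsto_nhdsWithin_iff.2 ⟨ts.prodMk_nhds (tt.prodMk_nhds ys), ?_⟩
        refine Eventually.of_forall fun n => ⟨?_, ?_, ?_⟩
        · have := hh0 n
          simp only; positivity
        · have := (hh0 n).le
          have := hmono n
          simp only; gcongr
        · exact (hkk1 n t (hs.trans hst)).trans ht
      exact h1.comp h2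
    have tR : Tendsto (fun n => K * (kk n t * h n - kk n s * h n) ^ θ) U
        (𝓝 (K * (t - s) ^ θ)) :=
      ((tt.sub ts).rpow_const (Or.inr (by linarith))).const_mul K
    refine le_of_tendsto_of_tendsto ((yt.sub tφ).norm) tR ?_
    filter_upwards [(tt.sub ts).eventually (ge_mem_nhds hd)] with n hn
    obtain ⟨j, hj⟩ := Nat.exists_eq_add_of_le (hmono n)
    have e : (kk n t : ℝ) * h n - kk n s * h n = j * h n := by rw [hj]; push_cast; ring
    rw [e] at hn ⊢
    have := hY1 n (kk n s) j (by rw [← hj]; exact (hkk1 n t (hs.trans hst)).trans ht) hn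
    rwa [← hj] at this
  obtain ⟨C, hC⟩ : ∃ C, C = K + (2 * B + L * T ^ γ) / δ ^ θ := ⟨_, rfl⟩
  have hC0 : 0 ≤ C := by rw [hC]; positivity
  have hglob : ∀ s t, 0 ≤ s → s ≤ t → t ≤ T → ‖y t - φ s t (y s)‖ ≤ C * (t - s) ^ θ := by
    intro s t hs hst ht
    have hts : 0 ≤ t - s := by linarith
    have hp : 0 ≤ (t - s) ^ θ := by positivity
    have hq : 0 ≤ (2 * B + L * T ^ γ) / δ ^ θ := by positivity
    rcases lt_or_ge (t - s) δ with hd | hd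
    · refine (hloc s t hs hst ht hd).trans ?_
      gcongr
      rw [hC]; linarith
    · have b1 := (hy t (hs.trans hst) ht).2
      have b2 := (hy s hs (hst.trans ht)).2
      have b3 := (hφ.nice s t hs hst ht).bdd (y s)
      have b4 : L * (t - s) ^ γ ≤ L * T ^ γ := by gcongr; linarith
      have e : y t - φ s t (y s) = (y t - a) - (y s - a) - (φ s t (y s) - y s) := by abel
      rw [e]
      have : ‖(y t - a) - (y s - a) - (φ s t (y s) - y s)‖ ≤ 2 * B + L * T ^ γ := by
        refine (norm_sub_le _ _).trans ?_
        have := norm_sub_le (y t - a) (y s - a)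
        linarith
      refine this.trans ?_
      have h2 : (2 * B + L * T ^ γ) ≤ (2 * B + L * T ^ γ) / δ ^ θ * (t - s) ^ θ := by
        have : δ ^ θ ≤ (t - s) ^ θ := by gcongr
        rw [div_mul_eq_mul_div, le_div_iff₀ (by positivity)]
        gcongr
      rw [hC]
      nlinarith
  refine ⟨y, C, hC0, ?_, ?_, hglob⟩
  · have hmod : ∀ s t, 0 ≤ s → s ≤ t → t ≤ T →
        ‖y t - y s‖ ≤ C * |t - s| ^ θ + L * |t - s| ^ γ := by
      intro s t hs hst ht
      have hts : 0 ≤ t - s := by linarith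
      rw [abs_of_nonneg hts]
      have e : y t - y s = (y t - φ s t (y s)) + (φ s t (y s) - y s) := by abel
      rw [e]
      exact (norm_add_le _ _).trans (add_le_add (hglob s t hs hst ht)
        ((hφ.nice s t hs hst ht).bdd (y s)))
    intro t0 ht0
    rw [ContinuousWithinAt, tendsto_iff_norm_sub_tendsto_zero]
    refine squeeze_zero' (g := fun t => C * |t - t0| ^ θ + L * |t - t0| ^ γ)
      (Eventually.of_forall fun _ => norm_nonneg _) ?_ ?_
    · filter_upwards [self_mem_nhdsWithin] with t ht
      rcases le_total t0 t with hc | hc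
      · exact hmod t0 t ht0.1 hc ht.2
      · rw [norm_sub_rev, abs_sub_comm]
        exact hmod t t0 ht.1 hc ht0.2
    · have c : Continuous (fun t : ℝ => C * |t - t0| ^ θ + L * |t - t0| ^ γ) := by
        have c1 : Continuous (fun t : ℝ => |t - t0|) := by fun_prop
        exact ((c1.rpow_const fun _ => Or.inr (by linarith)).const_mul C).add
          ((c1.rpow_const fun _ => Or.inr hγ.le).const_mul L)
      have := c.tendsto t0
      simp only [sub_self, abs_zero, Real.zero_rpow hγ.ne', Real.zero_rpow (show θ ≠ 0 by linarith),
        mul_zero, add_zero] at this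
      exact this.mono_left nhdsWithin_le_nhds
  · have h1 := (hy 0 le_rfl hT.le).1
    have h2 : (fun n => Y n (kk n 0)) = fun _ => a := by
      funext n; simp [Y, kk, cmpN]
    rw [h2] at h1
    exact tendsto_nhds_unique h1 tendsto_const_nhds

end Existence

section Final

open Filter Topology

theorem nice_of_C2 {E F : Type*} [NormedAddCommGroup E] [NormedSpace ℝ E]
    [NormedAddCommGroup F] [NormedSpace ℝ F] {g : E → F} {M : ℝ} (hc : ContDiff ℝ 2 g)
    (h0 : ∀ z, ‖iteratedFDeriv ℝ 0 g z‖ ≤ M) (h1 : ∀ z, ‖iteratedFDeriv ℝ 1 g z‖ ≤ M)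
    (h2 : ∀ z, ‖iteratedFDeriv ℝ 2 g z‖ ≤ M) : Nice M g := by
  have c1 : ContDiff ℝ 1 (fderiv ℝ g) := hc.fderiv_right (by norm_num)
  have d0 : Differentiable ℝ g := hc.differentiable (by norm_num)
  have d1 : Differentiable ℝ (fderiv ℝ g) := c1.differentiable (by norm_num)
  have b0 : ∀ z, ‖g z‖ ≤ M := fun z => by
    have := h0 z; rw [norm_iteratedFDeriv_zero] at this; exact this
  have b1 : ∀ z, ‖fderiv ℝ g z‖ ≤ M := fun z => by
    have := h1 z; rw [norm_iteratedFDeriv_one] at this; exact this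
  have b2 : ∀ z, ‖fderiv ℝ (fderiv ℝ g) z‖ ≤ M := fun z => by
    have := h2 z
    rw [← norm_iteratedFDeriv_fderiv, norm_iteratedFDeriv_one] at this; exact this
  refine Nice.of_fderiv (fun z => (d0 z).hasFDerivAt) b0 b1 ?_
  intro z w
  exact Convex.norm_image_sub_le_of_norm_fderiv_le (fun x _ => d1 x) (fun x _ => b2 x)
    convex_univ (mem_univ w) (mem_univ z)

theorem nice_of_C3 {E F : Type*} [NormedAddCommGroup E] [NormedSpace ℝ E]
    [NormedAddCommGroup F] [NormedSpace ℝ F] {σ : E → F} (hσ : IsC3Bounded σ) :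
    ∃ M : ℝ, Nice M σ ∧ Nice M (fderiv ℝ σ) := by
  obtain ⟨hc, hb⟩ := hσ
  obtain ⟨B0, h0⟩ := hb 0 (by norm_num)
  obtain ⟨B1, h1⟩ := hb 1 (by norm_num)
  obtain ⟨B2, h2⟩ := hb 2 (by norm_num)
  obtain ⟨B3, h3⟩ := hb 3 (by norm_num)
  obtain ⟨M, m0, m1, m2, m3⟩ : ∃ M : ℝ, B0 ≤ M ∧ B1 ≤ M ∧ B2 ≤ M ∧ B3 ≤ M :=
    ⟨max (max B0 B1) (max B2 B3), by simp, by simp, by simp, by simp⟩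
  have c1 : ContDiff ℝ 2 (fderiv ℝ σ) := hc.fderiv_right (by norm_num)
  refine ⟨M, nice_of_C2 (hc.of_le (by norm_num)) (fun z => (h0 z).trans m0)
    (fun z => (h1 z).trans m1) (fun z => (h2 z).trans m2),
    nice_of_C2 c1 (fun z => ?_) (fun z => ?_) (fun z => ?_)⟩
  · rw [norm_iteratedFDeriv_fderiv]; exact (h1 z).trans m1
  · rw [norm_iteratedFDeriv_fderiv]; exact (h2 z).trans m2
  · rw [norm_iteratedFDeriv_fderiv]; exact (h3 z).trans m3

theorem Dvf_eq {d m : ℕ} {σ : Vec d → Vec m →L[ℝ] Vec d} (hσ : Differentiable ℝ σ)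
    (i j : Fin m) (z : Vec d) : Dvf d m σ i j z =
      fderiv ℝ σ z (σ z (EuclideanSpace.single i 1)) (EuclideanSpace.single j 1) := by
  unfold Dvf
  rw [fderiv_clm_apply (hσ z) (differentiableAt_const _)]
  simp

theorem sum_single {m : ℕ} (a : Vec m) : ∑ i, a i • EuclideanSpace.single i (1 : ℝ) = a := by
  have := (EuclideanSpace.basisFun (Fin m) ℝ).sum_repr a
  simpa using this

theorem sum_Dvf {d m : ℕ} {σ : Vec d → Vec m →L[ℝ] Vec d} (hσ : Differentiable ℝ σ)
    (a b : Vec m) (z : Vec d) : ∑ i, ∑ j, (a i * b j) • Dvf d m σ i j z =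
      fderiv ℝ σ z (σ z a) b := by
  conv_rhs => rw [← sum_single a, ← sum_single b]
  simp only [map_sum, map_smul, Dvf_eq hσ]
  rw [Finset.sum_comm]
  simp only [FunLike.coe_sum, Finset.sum_apply, FunLike.coe_smul, Pi.smul_apply,
    Finset.smul_sum, smul_smul]
  refine Finset.sum_congr rfl fun i _ => Finset.sum_congr rfl fun j _ => ?_
  rw [mul_comm]

/-- The second order term. -/
def Qt (d m : ℕ) (σ : Vec d → Vec m →L[ℝ] Vec d) (X2 : ℝ → ℝ → Mat m) (s t : ℝ) (z : Vec d) :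
    Vec d := ∑ i : Fin m, ∑ j : Fin m, X2 s t (i, j) • Dvf d m σ i j z

/-- The almost flow. -/
def phi (d m : ℕ) (σ : Vec d → Vec m →L[ℝ] Vec d) (x : ℝ → Vec m) (X2 : ℝ → ℝ → Mat m)
    (s t : ℝ) (z : Vec d) : Vec d := z + (σ z (x t - x s) + Qt d m σ X2 s t z)

theorem holder_bounds {m : ℕ} {γ T : ℝ} {x : ℝ → Vec m} {X2 : ℝ → ℝ → Mat m} (hγ : 0 < γ)
    (hrp : IsRoughPath m γ 0 T x X2) : ∃ A : ℝ, 0 ≤ A ∧ ∀ s t, 0 ≤ s → s ≤ t → t ≤ T →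
      ‖x t - x s‖ ≤ A * (t - s) ^ γ ∧ ‖X2 s t‖ ≤ A * ((t - s) ^ γ) ^ 2 := by
  obtain ⟨h1, -, h2, hch⟩ := hrp
  refine ⟨(holderENorm γ 0 T x).toReal + (holder2ENorm (2 * γ) 0 T X2).toReal, by positivity, ?_⟩
  intro s t hs hst ht
  have p1 : 0 ≤ (holderENorm γ 0 T x).toReal := ENNReal.toReal_nonneg
  have p2 : 0 ≤ (holder2ENorm (2 * γ) 0 T X2).toReal := ENNReal.toReal_nonneg
  rcases hst.eq_or_lt with rfl | hlt
  · constructor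
    · simp; positivity
    · have : X2 s s = 0 := by
        ext ⟨i, j⟩
        have := hch s s s hs le_rfl le_rfl ht i j
        simp at this
        simpa using this
      rw [this, norm_zero]; positivity
  · have hts : 0 < t - s := by linarith
    constructor
    · have : ENNReal.ofReal (‖x t - x s‖ / (t - s) ^ γ) ≤ holderENorm γ 0 T x :=
        le_iSup (fun p : {p : ℝ × ℝ // 0 ≤ p.1 ∧ p.1 < p.2 ∧ p.2 ≤ T} =>
          ENNReal.ofReal (‖x p.1.2 - x p.1.1‖ / (p.1.2 - p.1.1) ^ γ)) ⟨(s, t), hs, hlt, ht⟩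
      have := (ENNReal.ofReal_le_iff_le_toReal h1.ne).1 this
      rw [div_le_iff₀ (by positivity)] at this
      refine this.trans ?_
      gcongr
      linarith
    · have : ENNReal.ofReal (‖X2 s t‖ / (t - s) ^ (2 * γ)) ≤ holder2ENorm (2 * γ) 0 T X2 :=
        le_iSup (fun p : {p : ℝ × ℝ // 0 ≤ p.1 ∧ p.1 < p.2 ∧ p.2 ≤ T} =>
          ENNReal.ofReal (‖X2 p.1.1 p.1.2‖ / (p.1.2 - p.1.1) ^ (2 * γ))) ⟨(s, t), hs, hlt, ht⟩
      have := (ENNReal.ofReal_le_iff_le_toReal h2.ne).1 this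
      rw [div_le_iff₀ (by positivity)] at this
      refine this.trans ?_
      have e : (t - s) ^ (2 * γ) = ((t - s) ^ γ) ^ 2 := by
        rw [mul_comm, Real.rpow_mul hts.le]; norm_cast
      rw [e]
      gcongr
      linarith

theorem Qt_nice {d m : ℕ} {σ : Vec d → Vec m →L[ℝ] Vec d} (hσd : Differentiable ℝ σ) {M : ℝ}
    (hσ : Nice M σ) (hD : Nice M (fderiv ℝ σ)) (X2 : ℝ → ℝ → Mat m) (s t : ℝ) :
    Nice (m * (m * (‖X2 s t‖ * (3 * M ^ 2)))) (Qt d m σ X2 s t) := by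
  have h1 : ∀ i j : Fin m, Nice (3 * M ^ 2) (Dvf d m σ i j) := by
    intro i j
    have a1 := hσ.eval (EuclideanSpace.single i (1 : ℝ))
    have a2 := hD.apply (a1.mono (by simp))
    have a3 := (a2.eval (EuclideanSpace.single j (1 : ℝ))).mono (M' := 3 * M ^ 2) (by simp)
    have e : Dvf d m σ i j = fun z =>
      fderiv ℝ σ z (σ z (EuclideanSpace.single i 1)) (EuclideanSpace.single j 1) :=
      funext fun z => Dvf_eq hσd i j z
    rw [e]; exact a3
  have h2 : ∀ i j : Fin m, Nice (‖X2 s t‖ * (3 * M ^ 2))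
      (fun z => X2 s t (i, j) • Dvf d m σ i j z) := by
    intro i j
    refine ((h1 i j).smul _).mono ?_
    gcongr
    simpa using PiLp.norm_apply_le (X2 s t) (i, j)
  have h3 := Nice.sum (Finset.univ : Finset (Fin m)) fun i _ =>
    Nice.sum (Finset.univ : Finset (Fin m)) fun j _ => h2 i j
  have e : Qt d m σ X2 s t = fun z => ∑ i, ∑ j, X2 s t (i, j) • Dvf d m σ i j z := rfl
  rw [e]
  exact h3.mono (by simp)

theorem Qt_chen {d m : ℕ} {σ : Vec d → Vec m →L[ℝ] Vec d} (hσd : Differentiable ℝ σ)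
    {γ T : ℝ} {x : ℝ → Vec m} {X2 : ℝ → ℝ → Mat m} (hrp : IsRoughPath m γ 0 T x X2)
    (s u t : ℝ) (hs : 0 ≤ s) (hsu : s ≤ u) (hut : u ≤ t) (ht : t ≤ T) (z : Vec d) :
    Qt d m σ X2 s t z = Qt d m σ X2 s u z + Qt d m σ X2 u t z +
      fderiv ℝ σ z (σ z (x u - x s)) (x t - x u) := by
  rw [← sum_Dvf hσd]
  simp only [Qt, ← Finset.sum_add_distrib, ← add_smul]
  refine Finset.sum_congr rfl fun i _ => Finset.sum_congr rfl fun j _ => ?_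
  congr 1
  have := hrp.2.2.2 s u t hs hsu hut ht i j
  simp only [PiLp.sub_apply]
  linarith

theorem phi_almostFlow {d m : ℕ} {σ : Vec d → Vec m →L[ℝ] Vec d} (hσ : IsC3Bounded σ)
    {γ T : ℝ} (hγ : 0 < γ) (hT : 0 < T) {x : ℝ → Vec m} {X2 : ℝ → ℝ → Mat m}
    (hrp : IsRoughPath m γ 0 T x X2) :
    ∃ L : ℝ, 0 ≤ L ∧ AlmostFlow (phi d m σ x X2) T L γ (3 * γ) := by
  have hσd : Differentiable ℝ σ := hσ.1.differentiable (by norm_num)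
  obtain ⟨M0, hn1, hn2⟩ := nice_of_C3 hσ
  obtain ⟨A, hA0, hA⟩ := holder_bounds hγ hrp
  have hM0 := hn1.nonneg
  obtain ⟨M, hM⟩ : ∃ M, M = 1 + M0 + A + T ^ γ + m * (m * (A * (3 * M0 ^ 2))) := ⟨_, rfl⟩
  have q1 : 0 ≤ T ^ γ := by positivity
  have q2 : 0 ≤ m * (m * (A * (3 * M0 ^ 2))) := by positivity
  have hM1 : 1 ≤ M := by linarith
  have hMM0 : M0 ≤ M := by linarith
  have hMA : A ≤ M := by linarith
  have hMT : T ^ γ ≤ M := by linarith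
  have hMQ : m * (m * (A * (3 * M0 ^ 2))) ≤ M := by linarith
  have hQ : ∀ s t, 0 ≤ s → s ≤ t → t ≤ T → Nice (M * ((t - s) ^ γ) ^ 2) (Qt d m σ X2 s t) := by
    intro s t hs hst ht
    refine (Qt_nice hσd hn1 hn2 X2 s t).mono ?_
    calc (m : ℝ) * (m * (‖X2 s t‖ * (3 * M0 ^ 2)))
        ≤ m * (m * ((A * ((t - s) ^ γ) ^ 2) * (3 * M0 ^ 2))) := by
          gcongr; exact (hA s t hs hst ht).2
      _ = (m * (m * (A * (3 * M0 ^ 2)))) * ((t - s) ^ γ) ^ 2 := by ring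
      _ ≤ _ := by gcongr
  have hx : ∀ s t, 0 ≤ s → s ≤ t → t ≤ T → ‖x t - x s‖ ≤ M * (t - s) ^ γ := by
    intro s t hs hst ht
    have : 0 ≤ t - s := by linarith
    exact (hA s t hs hst ht).1.trans (by gcongr)
  have hσM := hn1.mono hMM0
  have hDM := hn2.mono hMM0
  have hdefC : 0 ≤ defC M := by
    have : 0 ≤ M := by linarith
    unfold defC; positivity
  refine ⟨2 * M ^ 2 + defC M, by positivity, ?_⟩
  have hdef : ∀ s u t, 0 ≤ s → s ≤ u → u ≤ t → t ≤ T →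
      (∀ z, ‖phi d m σ x X2 u t (phi d m σ x X2 s u z) - phi d m σ x X2 s t z‖ ≤
        defC M * ((t - s) ^ γ) ^ 3) ∧ ∀ z w,
      ‖phi d m σ x X2 u t (phi d m σ x X2 s u z) - phi d m σ x X2 s t z -
        (phi d m σ x X2 u t (phi d m σ x X2 s u w) - phi d m σ x X2 s t w)‖ ≤
        defC M * ((t - s) ^ γ) ^ 3 * ‖z - w‖ := by
    intro s u t hs hsu hut ht
    have hsu' : 0 ≤ u - s := by linarith
    have hut' : 0 ≤ t - u := by linarith
    have hst' : 0 ≤ t - s := by linarith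
    have e1 : (u - s) ^ γ ≤ (t - s) ^ γ := by gcongr
    have e2 : (t - u) ^ γ ≤ (t - s) ^ γ := by gcongr
    have e3 : (t - s) ^ γ ≤ T ^ γ := by gcongr; linarith
    refine defect_est (M := M) (ε := (t - s) ^ γ) (σ := σ) (D := fderiv ℝ σ)
      (Q1 := Qt d m σ X2 s u) (Q2 := Qt d m σ X2 u t) (a := x u - x s) (b := x t - x u)
      hM1 (by positivity) (e3.trans hMT) (fun z => (hσd z).hasFDerivAt) hσM hDM
      ((hQ s u hs hsu (hut.trans ht)).mono (by gcongr))
      ((hQ u t (hs.trans hsu) hut ht).mono (by gcongr))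
      ((hx s u hs hsu (hut.trans ht)).trans (by gcongr))
      ((hx u t (hs.trans hsu) hut ht).trans (by gcongr))
      (fun z => phi d m σ x X2 u t (phi d m σ x X2 s u z) - phi d m σ x X2 s t z) ?_
    intro z
    have e4 : x t - x s = (x u - x s) + (x t - x u) := by abel
    simp only [phi]
    rw [Qt_chen hσd hrp s u t hs hsu hut ht z, e4]
    simp only [map_add, sub_apply, add_apply]
    abel
  have e3 : ∀ s t : ℝ, s ≤ t → (t - s) ^ (3 * γ) = ((t - s) ^ γ) ^ 3 := by
    intro s t hst
    rw [mul_comm, Real.rpow_mul (by linarith)]; norm_cast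
  constructor
  · intro s t hs hst ht
    have hst' : 0 ≤ t - s := by linarith
    have e3 : (t - s) ^ γ ≤ T ^ γ := by gcongr; linarith
    have := g_nice hM1 (by positivity) (e3.trans hMT) hσM (hQ s t hs hst ht) (hx s t hs hst ht)
    simp only [phi, add_sub_cancel_left]
    refine this.mono ?_
    gcongr
    linarith
  · intro s u t hs hsu hut ht z
    have hst' : 0 ≤ t - s := by linarith
    refine ((hdef s u t hs hsu hut ht).1 z).trans ?_
    rw [e3 s t (by linarith)]
    gcongr
    nlinarith
  · intro s u t hs hsu hut ht z w
    have hst' : 0 ≤ t - s := by linarith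
    refine ((hdef s u t hs hsu hut ht).2 z w).trans ?_
    rw [e3 s t (by linarith)]
    gcongr
    nlinarith

theorem phi_cont {d m : ℕ} {σ : Vec d → Vec m →L[ℝ] Vec d} (hσ : IsC3Bounded σ)
    {γ T : ℝ} (hγ : 0 < γ) {x : ℝ → Vec m} {X2 : ℝ → ℝ → Mat m}
    (hrp : IsRoughPath m γ 0 T x X2) :
    ContinuousOn (fun p : ℝ × ℝ × Vec d => phi d m σ x X2 p.1 p.2.1 p.2.2)
      {p | 0 ≤ p.1 ∧ p.1 ≤ p.2.1 ∧ p.2.1 ≤ T} := by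
  have hσd : Differentiable ℝ σ := hσ.1.differentiable (by norm_num)
  have hσc : Continuous σ := hσ.1.continuous
  have hDc : Continuous (fderiv ℝ σ) := hσ.1.continuous_fderiv (by norm_num)
  obtain ⟨A, hA0, hA⟩ := holder_bounds hγ hrp
  have hx : ContinuousOn x (Icc 0 T) := by
    intro t0 ht0
    rw [ContinuousWithinAt, tendsto_iff_norm_sub_tendsto_zero]
    refine squeeze_zero' (g := fun t => A * |t - t0| ^ γ)
      (Eventually.of_forall fun _ => norm_nonneg _) ?_ ?_
    · filter_upwards [self_mem_nhdsWithin] with t ht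
      rcases le_total t0 t with hc | hc
      · rw [abs_of_nonneg (by linarith)]
        exact (hA t0 t ht0.1 hc ht.2).1
      · rw [norm_sub_rev, abs_sub_comm, abs_of_nonneg (by linarith)]
        exact (hA t t0 ht.1 hc ht0.2).1
    · have c : Continuous (fun t : ℝ => A * |t - t0| ^ γ) := by
        have c1 : Continuous (fun t : ℝ => |t - t0|) := by fun_prop
        exact (c1.rpow_const fun _ => Or.inr hγ.le).const_mul A
      have := c.tendsto t0
      simp only [sub_self, abs_zero, Real.zero_rpow hγ.ne', mul_zero] at this
      exact this.mono_left nhdsWithin_le_nhds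
  set S : Set (ℝ × ℝ × Vec d) := {p | 0 ≤ p.1 ∧ p.1 ≤ p.2.1 ∧ p.2.1 ≤ T}
  have x1 : ContinuousOn (fun p : ℝ × ℝ × Vec d => x p.1) S :=
    hx.comp continuous_fst.continuousOn fun p hp => ⟨hp.1, hp.2.1.trans hp.2.2⟩
  have x2 : ContinuousOn (fun p : ℝ × ℝ × Vec d => x p.2.1) S :=
    hx.comp (by fun_prop) fun p hp => ⟨hp.1.trans hp.2.1, hp.2.2⟩
  have XX : ContinuousOn (fun p : ℝ × ℝ × Vec d => X2 p.1 p.2.1) S :=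
    hrp.2.1.comp (f := fun p : ℝ × ℝ × Vec d => (p.1, p.2.1)) (by fun_prop) fun p hp => hp
  have s1 : ContinuousOn (fun p : ℝ × ℝ × Vec d => σ p.2.2) S :=
    (hσc.comp (by fun_prop)).continuousOn
  have hV : ∀ i j, Continuous (Dvf d m σ i j) := by
    intro i j
    have e : Dvf d m σ i j = fun z =>
      fderiv ℝ σ z (σ z (EuclideanSpace.single i 1)) (EuclideanSpace.single j 1) :=
      funext fun z => Dvf_eq hσd i j z
    rw [e]
    exact (hDc.clm_apply (hσc.clm_apply continuous_const)).clm_apply continuous_const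
  have hVc : ∀ i j, ContinuousOn (fun p : ℝ × ℝ × Vec d => Dvf d m σ i j p.2.2) S := by
    intro i j
    have h22 : Continuous (fun p : ℝ × ℝ × Vec d => p.2.2) := by fun_prop
    exact ((hV i j).comp h22).continuousOn
  unfold phi Qt
  refine ContinuousOn.add (by fun_prop) (ContinuousOn.add (s1.clm_apply (x2.sub x1)) ?_)
  refine continuousOn_finsetSum _ fun i _ => continuousOn_finsetSum _ fun j _ => ?_
  have hX : ContinuousOn (fun p : ℝ × ℝ × Vec d => X2 p.1 p.2.1 (i, j)) S :=
    (EuclideanSpace.proj (𝕜 := ℝ) (i, j)).continuous.comp_continuousOn XX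
  exact hX.smul (hVc i j)

end Final

/-- **Existence and uniqueness for rough differential equations (Davie formulation).**
For `1/3 < κ < γ ≤ 1`, a γ-rough path `(x, X²)` over `[0,T]`, a `C³` bounded `σ` with bounded
derivatives and an initial condition `a`, there is exactly one continuous path on `[0,T]`
which is a solution with exponent `3κ` of `dy = σ(y)dx`, `y_0 = a`. -/
theorem rde_existence_uniqueness (d m : ℕ) (κ γ T : ℝ)
    (hκ : 1 / 3 < κ) (hκγ : κ < γ) (hγ : γ ≤ 1) (hT : 0 < T)
    (σ : Vec d → Vec m →L[ℝ] Vec d) (hσ : IsC3Bounded σ) (a : Vec d)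
    (x : ℝ → Vec m) (X2 : ℝ → ℝ → Mat m) (hrp : IsRoughPath m γ 0 T x X2) :
    ∃ y : ℝ → Vec d, IsRDESolution d m (3 * κ) T σ x X2 a y ∧
      ∀ y' : ℝ → Vec d, IsRDESolution d m (3 * κ) T σ x X2 a y' →
        ∀ t ∈ Icc (0 : ℝ) T, y' t = y t := by
  have hγ0 : 0 < γ := by linarith
  obtain ⟨L, hL, hφ⟩ := phi_almostFlow hσ hγ0 hT hrp
  have hc := phi_cont (d := d) hσ hγ0 hrp
  obtain ⟨y, C, hC, hyc, hy0, hy⟩ := hφ.exists_sol hL hγ0 (by linarith) hT hc a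
  have hrw : ∀ (y : ℝ → Vec d) (s t : ℝ), y t - y s - σ (y s) (x t - x s) -
        ∑ i : Fin m, ∑ j : Fin m, X2 s t (i, j) • Dvf d m σ i j (y s) =
        y t - phi d m σ x X2 s t (y s) := by
    intro y s t
    simp only [phi, Qt]
    abel
  have hyκ : ∀ s t, 0 ≤ s → s ≤ t → t ≤ T → ‖y t - phi d m σ x X2 s t (y s)‖ ≤
      (C * T ^ (3 * γ - 3 * κ)) * (t - s) ^ (3 * κ) := by
    intro s t hs hst ht
    have hst' : 0 ≤ t - s := by linarith
    refine (hy s t hs hst ht).trans ?_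
    have e : (t - s) ^ (3 * γ) = (t - s) ^ (3 * γ - 3 * κ) * (t - s) ^ (3 * κ) := by
      rw [← Real.rpow_add_of_nonneg hst' (by linarith) (by linarith)]
      congr 1; ring
    rw [e, ← mul_assoc]
    gcongr
    · linarith
    · linarith
  refine ⟨y, ⟨hyc, hy0, C * T ^ (3 * γ - 3 * κ), fun s t hs hst ht => ?_⟩, ?_⟩
  · rw [hrw]; exact hyκ s t hs hst ht
  · rintro y' ⟨-, hy'0, C', hy'⟩ t ht
    refine hφ.unique hL hγ0 (by linarith) (show 1 < 3 * κ by linarith) (C := C') ?_ hyκ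
      (by rw [hy0, hy'0]) t ht.1 ht.2
    intro s t hs hst ht
    rw [← hrw]; exact hy' s t hs hst ht

end
end

section
/- Local Lipschitz continuity of the Itô map (Theorem 2.6(2)): Let 1/3 < κ < γ ≤ 1, T > 0, and let σ ∈ C³(ℝ^d; ℝ^{d×m}) be bounded with bounded derivatives up to order three. Then there exists a function K_T : ℝ⁴ → [0,∞), nondecreasing in each argument and depending only on T, σ, γ, κ, d, m, with the following property: if (x, X²) and (x̃, X̃²) are γ-rough paths over [0,T] with values in ℝ^m, a, ã ∈ ℝ^d, and y, ỹ are the solutions with exponent 3κ of dy = σ(y)dx, y_0 = a, and dỹ = σ(ỹ)dx̃, ỹ_0 = ã, respectively, then ‖y − ỹ‖_{γ,∞,T} ≤ K_T(‖x‖_{γ,∞,T}, ‖x̃‖_{γ,∞,T}, ‖X²‖_{2γ}, ‖X̃²‖_{2γ}) · ( |a − ã| + ‖x − x̃‖_{γ,∞,T} + ‖X² − X̃²‖_{2γ} ), where ‖f‖_{γ,∞,T} = sup_{t∈[0,T]} |f_t| + sup_{s≠t} |f_t − f_s|/|t−s|^γ and ‖X² − X̃²‖_{2γ} = sup_{s<t}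 |X²_{st} − X̃²_{st}|/(t−s)^{2γ}. -/
open Set
open scoped ENNReal

noncomputable section

set_option linter.unusedSectionVars false

namespace Ito

/-- Bounded, Lipschitz, with a second-difference estimate. -/
structure Nice {E F : Type*} [NormedAddCommGroup E] [NormedAddCommGroup F]
    (f : E → F) (B : ℝ) : Prop where
  bd : ∀ z, ‖f z‖ ≤ B
  lip : ∀ p q, ‖f p - f q‖ ≤ B * ‖p - q‖
  sd : ∀ p q p' q', ‖(f q - f p) - (f q' - f p')‖ ≤
    B * (‖p - p'‖ * ‖q - p‖ + ‖(q - p) - (q' - p')‖)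

section nice
variable {E F G H : Type*} [NormedAddCommGroup E] [NormedSpace ℝ E]
  [NormedAddCommGroup F] [NormedSpace ℝ F] [NormedAddCommGroup G] [NormedSpace ℝ G]
  [NormedAddCommGroup H] [NormedSpace ℝ H]

theorem Nice.nonneg {f : E → F} {B : ℝ} (h : Nice f B) : 0 ≤ B :=
  (norm_nonneg _).trans (h.bd 0)

theorem Nice.mono {f : E → F} {B B' : ℝ} (h : Nice f B) (hB : B ≤ B') : Nice f B' where
  bd z := (h.bd z).trans hB
  lip p q := (h.lip p q).trans (by gcongr)
  sd p q p' q' := (h.sd p q p' q').trans (by gcongr)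

theorem Nice.clm {f : E → F} {B : ℝ} (h : Nice f B) (Λ : F →L[ℝ] G) :
    Nice (fun z => Λ (f z)) (‖Λ‖ * B) where
  bd z := Λ.le_opNorm_of_le (h.bd z)
  lip p q := by
    rw [← map_sub, mul_assoc]; exact Λ.le_opNorm_of_le (h.lip p q)
  sd p q p' q' := by
    simp only [← map_sub]; rw [mul_assoc]; exact Λ.le_opNorm_of_le (h.sd p q p' q')

/-- A differentiable bounded function with bounded Lipschitz derivative is nice. -/
theorem nice_of_deriv {f : E → F} {f' : E → E →L[ℝ] F} {B : ℝ}
    (hf : ∀ z, HasFDerivAt f (f' z) z) (hb : ∀ z, ‖f z‖ ≤ B) (hb' : ∀ z, ‖f' z‖ ≤ B)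
    (hl : ∀ p q, ‖f' p - f' q‖ ≤ B * ‖p - q‖) : Nice f B := by
  have lip : ∀ p q, ‖f p - f q‖ ≤ B * ‖p - q‖ := fun p q =>
    convex_univ.norm_image_sub_le_of_norm_hasFDerivWithin_le
      (fun z _ => (hf z).hasFDerivWithinAt) (fun z _ => hb' z) (mem_univ q) (mem_univ p)
  refine ⟨hb, lip, fun p q p' q' => ?_⟩
  have h1 : ‖(f (p + (q - p)) - f p) - (f (p' + (q - p)) - f p')‖ ≤
      (B * ‖q - p‖) * ‖p - p'‖ := by
    refine convex_univ.norm_image_sub_le_of_norm_hasFDerivWithin_le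
      (f := fun z => f (z + (q - p)) - f z) (f' := fun z => f' (z + (q - p)) - f' z)
      (fun z _ => ?_) (fun z _ => ?_) (mem_univ p') (mem_univ p)
    · exact (((hasFDerivAt_comp_add_right (q - p)).2 (hf (z + (q - p)))).sub (hf z)).hasFDerivWithinAt
    · refine (hl _ _).trans (le_of_eq ?_)
      congr 2; abel
  have h2 := lip (p' + (q - p)) q'
  have e : (f q - f p) - (f q' - f p') =
    ((f (p + (q - p)) - f p) - (f (p' + (q - p)) - f p')) + (f (p' + (q - p)) - f q') := by
    rw [add_sub_cancel]; abel
  rw [e]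
  refine (norm_add_le _ _).trans ?_
  have e2 : p' + (q - p) - q' = (q - p) - (q' - p') := by abel
  rw [e2] at h2
  linarith

theorem Nice.bilin {f : E → F} {g : E → G} {B C : ℝ} (hf : Nice f B) (hg : Nice g C)
    (b : F →L[ℝ] G →L[ℝ] H) :
    Nice (fun z => b (f z) (g z)) (‖b‖ * (6 * (B * C))) := by
  have hB := hf.nonneg
  have hC := hg.nonneg
  have hBC : 0 ≤ B * C := mul_nonneg hB hC
  have key : ∀ u v a c, ‖u‖ ≤ a → ‖v‖ ≤ c → ‖b u v‖ ≤ ‖b‖ * (a * c) := fun u v a c h1 h2 => by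
    refine (b.le_opNorm₂ u v).trans ?_
    rw [mul_assoc]
    have := (norm_nonneg u).trans h1
    gcongr
  refine ⟨fun z => ?_, fun p q => ?_, fun p q p' q' => ?_⟩
  · refine (key _ _ _ _ (hf.bd z) (hg.bd z)).trans ?_
    exact mul_le_mul_of_nonneg_left (by linarith) (norm_nonneg b)
  · have e : b (f p) (g p) - b (f q) (g q) = b (f p - f q) (g p) + b (f q) (g p - g q) := by
      simp
    rw [e]
    refine (norm_add_le _ _).trans ?_
    have h1 := key _ _ _ _ (hf.lip p q) (hg.bd p)
    have h2 := key _ _ _ _ (hf.bd q) (hg.lip p q)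
    have : 0 ≤ ‖b‖ * (B * C) * ‖p - q‖ := by positivity
    nlinarith
  · have e : (b (f q) (g q) - b (f p) (g p)) - (b (f q') (g q') - b (f p') (g p')) =
      (b ((f q - f p) - (f q' - f p')) (g q') + b (f q - f p) (g p - g p'))
       + (b (f q - f p) ((g q - g p) - (g q' - g p')) + (b (f p - f p') (g q - g p)
        + b (f p') ((g q - g p) - (g q' - g p')))) := by
      simp; abel
    rw [e]
    have h1 := key _ _ _ _ (hf.sd p q p' q') (hg.bd q')
    have h2 := key _ _ _ _ (hf.lip q p) (hg.lip p p')
    have h3 := key (f q - f p) _ (2 * B) _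
      ((norm_sub_le _ _).trans (by linarith [hf.bd q, hf.bd p])) (hg.sd p q p' q')
    have h4 := key _ _ _ _ (hf.lip p p') (hg.lip q p)
    have h5 := key _ _ _ _ (hf.bd p') (hg.sd p q p' q')
    refine (norm_add_le _ _).trans ?_
    refine (add_le_add (norm_add_le _ _) ((norm_add_le _ _).trans
      (add_le_add_right (norm_add_le _ _) _))).trans ?_
    have t1 : 0 ≤ ‖b‖ * (B * C) * (‖p - p'‖ * ‖q - p‖) := by positivity
    have t2 : 0 ≤ ‖b‖ * (B * C) * ‖(q - p) - (q' - p')‖ := by positivity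
    nlinarith

/-- Difference estimate for first order Taylor remainders. -/
theorem taylor_diff {f : E → F} {f' : E → E →L[ℝ] F} {B : ℝ}
    (hf : ∀ z, HasFDerivAt f (f' z) z) (h : Nice f' B) (p q p' q' : E) :
    ‖(f (p + q) - f p - f' p q) - (f (p' + q') - f p' - f' p' q')‖ ≤
      B * (‖p - p'‖ * ‖q‖ ^ 2 + (‖q‖ + ‖q'‖) * ‖q - q'‖) := by
  have hB := h.nonneg
  have dG : ∀ p z, HasFDerivAt (fun q => f (p + q) - f p - f' p q) (f' (p + z) - f' p) z := by
    intro p z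
    exact (((hasFDerivAt_comp_add_left p).2 (hf (p + z))).sub_const _).sub (f' p).hasFDerivAt
  have h1 : ‖((f (p + q) - f p - f' p q) - (f (p' + q) - f p' - f' p' q)) -
      ((f (p + 0) - f p - f' p 0) - (f (p' + 0) - f p' - f' p' 0))‖ ≤
      (B * (‖p - p'‖ * ‖q‖)) * ‖q - 0‖ := by
    refine (convex_closedBall (0 : E) ‖q‖).norm_image_sub_le_of_norm_hasFDerivWithin_le
      (f := fun q => (f (p + q) - f p - f' p q) - (f (p' + q) - f p' - f' p' q))
      (f' := fun z => (f' (p + z) - f' p) - (f' (p' + z) - f' p'))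
      (fun z _ => ((dG p z).sub (dG p' z)).hasFDerivWithinAt) (fun z hz => ?_) (by simp) (by simp)
    refine (h.sd _ _ _ _).trans ?_
    simp only [add_sub_cancel_left, sub_self, norm_zero, add_zero]
    have : ‖z‖ ≤ ‖q‖ := by simpa using hz
    gcongr
  have h2 : ‖(f (p' + q) - f p' - f' p' q) - (f (p' + q') - f p' - f' p' q')‖ ≤
      (B * (‖q‖ + ‖q'‖)) * ‖q - q'‖ := by
    refine (convex_closedBall (0 : E) (‖q‖ + ‖q'‖)).norm_image_sub_le_of_norm_hasFDerivWithin_le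
      (f := fun q => f (p' + q) - f p' - f' p' q)
      (fun z _ => (dG p' z).hasFDerivWithinAt) (fun z hz => ?_) (by simp) (by simp)
    refine (h.lip _ _).trans ?_
    have : ‖z‖ ≤ ‖q‖ + ‖q'‖ := by simpa using hz
    rw [add_sub_cancel_left]
    gcongr
  simp only [add_zero, map_zero, sub_self, sub_zero] at h1
  have e : (f (p + q) - f p - f' p q) - (f (p' + q') - f p' - f' p' q') =
    ((f (p + q) - f p - f' p q) - (f (p' + q) - f p' - f' p' q)) +
    ((f (p' + q) - f p' - f' p' q) - (f (p' + q') - f p' - f' p' q')) := by abel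
  rw [e]
  refine (norm_add_le _ _).trans ((add_le_add h1 h2).trans (le_of_eq ?_))
  ring

theorem clm_diff {f g : F →L[ℝ] G} {x y : F} {a b c e : ℝ} (h1 : ‖f - g‖ ≤ a) (h2 : ‖x‖ ≤ b)
    (h3 : ‖g‖ ≤ c) (h4 : ‖x - y‖ ≤ e) : ‖f x - g y‖ ≤ a * b + c * e := by
  have : f x - g y = (f - g) x + g (x - y) := by simp
  rw [this]
  exact (norm_add_le _ _).trans (add_le_add (ContinuousLinearMap.le_of_opNorm_le_of_le _ h1 h2)
    (ContinuousLinearMap.le_of_opNorm_le_of_le _ h3 h4))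

end nice

/-- The contraction principle for bounds. -/
theorem contraction {ι : Type*} (f g : ι → ℝ) (hg : ∀ i, 0 ≤ g i) {r c : ℝ} (hr : 0 ≤ r)
    (hr1 : r < 1) (hc : 0 ≤ c)
    (step : ∀ N, 0 ≤ N → (∀ i, f i ≤ N * g i) → ∀ i, f i ≤ (c + r * N) * g i)
    {N₀ : ℝ} (hN₀ : ∀ i, f i ≤ N₀ * g i) : ∀ i, f i ≤ c / (1 - r) * g i := by
  have h1r : 0 < 1 - r := by linarith
  have hc' : 0 ≤ c / (1 - r) := by positivity
  have key : ∀ k : ℕ, ∀ i, f i ≤ (c / (1 - r) + r ^ k * |N₀|) * g i := by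
    intro k
    induction k with
    | zero =>
      intro i
      refine (hN₀ i).trans (mul_le_mul_of_nonneg_right ?_ (hg i))
      have := le_abs_self N₀
      simp; linarith
    | succ k ih =>
      intro i
      refine (step _ (by positivity) ih i).trans (le_of_eq ?_)
      field_simp
      ring
  intro i
  have h : Filter.Tendsto (fun k : ℕ => (c / (1 - r) + r ^ k * |N₀|) * g i) Filter.atTop
      (nhds ((c / (1 - r) + 0 * |N₀|) * g i)) :=
    (((tendsto_pow_atTop_nhds_zero_of_lt_one hr hr1).mul_const _).const_add _).mul_const _
  rw [zero_mul, add_zero] at h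
  exact ge_of_tendsto' h (fun k => key k i)

end Ito

namespace Ito
section static
variable {E V W : Type*} [NormedAddCommGroup E] [NormedSpace ℝ E]
  [NormedAddCommGroup V] [NormedSpace ℝ V] [NormedAddCommGroup W] [NormedSpace ℝ W]

/-- The estimates on the coefficients that the proof uses. -/
structure Coef (σ : E → V →L[ℝ] E) (S : E → E →L[ℝ] V →L[ℝ] E) (A : E → W →L[ℝ] E)
    (B : ℝ) : Prop where
  one : 1 ≤ B
  sb : ∀ z, ‖σ z‖ ≤ B
  sl : ∀ p q, ‖σ p - σ q‖ ≤ B * ‖p - q‖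
  Sb : ∀ z, ‖S z‖ ≤ B
  Sl : ∀ p q, ‖S p - S q‖ ≤ B * ‖p - q‖
  G : ∀ p q p' q', ‖(σ q - σ p - S p (q - p)) - (σ q' - σ p' - S p' (q' - p'))‖ ≤
      B * (‖p - p'‖ * ‖q - p‖ ^ 2 + (‖q - p‖ + ‖q' - p'‖) * ‖(q - p) - (q' - p')‖)
  An : Nice A B

variable {σ : E → V →L[ℝ] E} {S : E → E →L[ℝ] V →L[ℝ] E} {A : E → W →L[ℝ] E} {B : ℝ}

theorem Coef.G1 (H : Coef σ S A B) (p q : E) : ‖σ q - σ p - S p (q - p)‖ ≤ B * ‖q - p‖ ^ 2 := by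
  have := H.G p q p p
  simp only [sub_self, norm_zero, map_zero, sub_zero, zero_mul, zero_add, add_zero] at this
  rwa [← pow_two] at this

/-- The defect `δJ`. -/
def Theta (σ : E → V →L[ℝ] E) (S : E → E →L[ℝ] V →L[ℝ] E) (A : E → W →L[ℝ] E)
    (p q : E) (v v' : V) (X' : W) : E :=
  (σ q - σ p - S p (σ p v)) v' + (A q - A p) X'

theorem Theta_bound (H : Coef σ S A B) {L N w : ℝ} (hL : 1 ≤ L) (hN : 0 ≤ N) (hw : 0 ≤ w)
    (hw1 : w ≤ 1) {p q j : E} {v v' : V} {X X' : W}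
    (hq : q = p + σ p v + A p X + j) (hv : ‖v‖ ≤ L * w) (hv' : ‖v'‖ ≤ L * w)
    (hX : ‖X‖ ≤ L * w ^ 2) (hX' : ‖X'‖ ≤ L * w ^ 2) (hj : ‖j‖ ≤ N * w ^ 3) :
    ‖Theta σ S A p q v v' X'‖ ≤ (4*B^3*L^3 + 3*B^2*L^2 + 2*B*L) * (1 + N * w) * w ^ 3 := by
  have hB := H.one
  have hw2 : w ^ 2 ≤ w := by nlinarith
  have h1 : ‖σ p v‖ ≤ B * (L * w) := ContinuousLinearMap.le_of_opNorm_le_of_le _ (H.sb p) hv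
  have h2 : ‖A p X‖ ≤ B * (L * w ^ 2) :=
    ContinuousLinearMap.le_of_opNorm_le_of_le _ (H.An.bd p) hX
  have h3 : ‖σ p v + A p X‖ ≤ 2 * B * L * w := by
    refine (norm_add_le _ _).trans ((add_le_add h1 h2).trans ?_)
    have : B * L * w ^ 2 ≤ B * L * w := by gcongr
    linarith
  have h4 : ‖σ q - σ (p + (σ p v + A p X))‖ ≤ B * (N * w ^ 3) := by
    refine (H.sl _ _).trans ?_
    have : q - (p + (σ p v + A p X)) = j := by rw [hq]; abel
    rw [this]; gcongr
  have h5 : ‖σ (p + (σ p v + A p X)) - σ p - S p (σ p v + A p X)‖ ≤ B * (2 * B * L * w) ^ 2 := by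
    have := H.G1 p (p + (σ p v + A p X))
    rw [add_sub_cancel_left] at this
    refine this.trans ?_
    gcongr
  have h6 : ‖S p (A p X)‖ ≤ B * (B * (L * w ^ 2)) :=
    ContinuousLinearMap.le_of_opNorm_le_of_le _ (H.Sb p) h2
  have h7 : ‖σ q - σ p - S p (σ p v)‖ ≤
      B * (N * w ^ 3) + B * (2 * B * L * w) ^ 2 + B * (B * (L * w ^ 2)) := by
    have e : σ q - σ p - S p (σ p v) = (σ q - σ (p + (σ p v + A p X))) +
      (σ (p + (σ p v + A p X)) - σ p - S p (σ p v + A p X)) + S p (A p X) := by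
      rw [map_add]; abel
    rw [e]
    exact norm_add₃_le.trans (add_le_add (add_le_add h4 h5) h6)
  have h8 : ‖A q - A p‖ ≤ B * (2 * B * L * w + N * w ^ 3) := by
    refine (H.An.lip _ _).trans ?_
    have : q - p = (σ p v + A p X) + j := by rw [hq]; abel
    rw [this]
    gcongr
    exact (norm_add_le _ _).trans (add_le_add h3 hj)
  have h9 := ContinuousLinearMap.le_of_opNorm_le_of_le _ h7 hv'
  have h10 := ContinuousLinearMap.le_of_opNorm_le_of_le _ h8 hX'
  refine (norm_add_le _ _).trans ((add_le_add h9 h10).trans ?_)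
  have t1 : B * L * N * w ^ 5 ≤ B * L * N * w ^ 4 :=
    mul_le_mul_of_nonneg_left (pow_le_pow_of_le_one hw hw1 (by norm_num)) (by positivity)
  have t2 : 0 ≤ (4*B^3*L^3 + 3*B^2*L^2) * (N * w ^ 4) := by positivity
  have t3 : 0 ≤ 2*B*L * w ^ 3 := by positivity
  linarith

theorem incr_diff (H : Coef σ S A B) {L Z ε a b : ℝ} (hL : 1 ≤ L) (hZ : 0 ≤ Z) (hε : 0 ≤ ε)
    (ha : 0 ≤ a) (hba : b ≤ a) {p p' : E} {v v' : V} {X X' : W}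
    (hz : ‖p - p'‖ ≤ Z) (hv : ‖v‖ ≤ L * a) (hX : ‖X‖ ≤ L * b)
    (dv : ‖v - v'‖ ≤ ε * a) (dX : ‖X - X'‖ ≤ ε * b) :
    ‖(σ p v + A p X) - (σ p' v' + A p' X')‖ ≤ 2 * B * L * (Z + ε) * a := by
  have hB := H.one
  have h1 := clm_diff ((H.sl p p').trans (mul_le_mul_of_nonneg_left hz (by linarith))) hv
    (H.sb p') dv
  have h2 := clm_diff ((H.An.lip p p').trans (mul_le_mul_of_nonneg_left hz (by linarith))) hX
    (H.An.bd p') dX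
  have e : (σ p v + A p X) - (σ p' v' + A p' X') = (σ p v - σ p' v') + (A p X - A p' X') := by
    abel
  rw [e]
  refine (norm_add_le _ _).trans ((add_le_add h1 h2).trans ?_)
  have t1 : B * Z * (L * b) ≤ B * Z * (L * a) := by gcongr
  have t2 : B * (ε * b) ≤ B * (ε * a) := by gcongr
  have t3 : B * 1 * (ε * a) ≤ B * L * (ε * a) := by gcongr
  linarith

/-- Constant of the difference estimate. -/
def C2 (B L N₀ : ℝ) : ℝ :=
  let Q := 2 * B * L + N₀
  (B * (Q ^ 2 + 4 * Q * B * L) + 2 * B ^ 2 * L + B * N₀ + B ^ 2) * L + (2 * Q * B + B) * L +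
    (B * Q ^ 2 + B ^ 2 * L + B * N₀) + (B * Q + 2 * B ^ 2 * L) * L + B * L + B * Q

theorem Theta_diff (H : Coef σ S A B) {L N N₀ Z ε w : ℝ} (hL : 1 ≤ L) (hN : 0 ≤ N)
    (hN₀ : 0 ≤ N₀) (hZ : 0 ≤ Z) (hε : 0 ≤ ε) (hw : 0 ≤ w) (hw1 : w ≤ 1)
    {p q j p' q' j' : E} {v u v' u' : V} {X Y X' Y' : W}
    (hq : q = p + σ p v + A p X + j) (hq' : q' = p' + σ p' v' + A p' X' + j')
    (hv : ‖v‖ ≤ L * w) (hu : ‖u‖ ≤ L * w) (hX : ‖X‖ ≤ L * w ^ 2) (hY : ‖Y‖ ≤ L * w ^ 2)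
    (hj : ‖j‖ ≤ N₀ * w ^ 3)
    (hv' : ‖v'‖ ≤ L * w) (hX' : ‖X'‖ ≤ L * w ^ 2)
    (hj' : ‖j'‖ ≤ N₀ * w ^ 3)
    (dv : ‖v - v'‖ ≤ ε * w) (du : ‖u - u'‖ ≤ ε * w) (dX : ‖X - X'‖ ≤ ε * w ^ 2)
    (dY : ‖Y - Y'‖ ≤ ε * w ^ 2) (dj : ‖j - j'‖ ≤ N * w ^ 3) (hz : ‖p - p'‖ ≤ Z) :
    ‖Theta σ S A p q v u Y - Theta σ S A p' q' v' u' Y'‖ ≤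
      C2 B L N₀ * (Z + ε + N * w) * w ^ 3 := by
  have hB := H.one
  have hw2 : w ^ 2 ≤ w := by nlinarith
  have hw32 : w ^ 3 ≤ w ^ 2 := pow_le_pow_of_le_one hw hw1 (by norm_num)
  have hw31 : w ^ 3 ≤ w := hw32.trans hw2
  have hw43 : w ^ 4 ≤ w ^ 3 := pow_le_pow_of_le_one hw hw1 (by norm_num)
  have hw54 : w ^ 5 ≤ w ^ 4 := pow_le_pow_of_le_one hw hw1 (by norm_num)
  simp only [C2]
  set Q := 2 * B * L + N₀ with hQ
  have hQ0 : 0 ≤ Q := by positivity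
  set e := Z + ε with he
  have he0 : 0 ≤ e := by positivity
  have hZe : Z ≤ e := by linarith
  have hεe : ε ≤ e := by linarith
  -- increments
  have nq : ∀ {p q j : E} {v : V} {X : W}, q = p + σ p v + A p X + j → ‖v‖ ≤ L * w →
      ‖X‖ ≤ L * w ^ 2 → ‖j‖ ≤ N₀ * w ^ 3 → ‖q - p‖ ≤ Q * w := by
    intro p q j v X hq hv hX hj
    have h1 : ‖σ p v‖ ≤ B * (L * w) := ContinuousLinearMap.le_of_opNorm_le_of_le _ (H.sb p) hv
    have h2 : ‖A p X‖ ≤ B * (L * w ^ 2) :=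
      ContinuousLinearMap.le_of_opNorm_le_of_le _ (H.An.bd p) hX
    have e1 : q - p = σ p v + A p X + j := by rw [hq]; abel
    rw [e1]
    refine norm_add₃_le.trans ((add_le_add (add_le_add h1 h2) hj).trans ?_)
    have t1 : B * L * w ^ 2 ≤ B * L * w := by gcongr
    have t2 : N₀ * w ^ 3 ≤ N₀ * w := by gcongr
    rw [hQ]; linarith
  have nq1 := nq hq hv hX hj
  have nq2 := nq hq' hv' hX' hj'
  have dq : ‖(q - p) - (q' - p')‖ ≤ 2 * B * L * e * w + N * w ^ 3 := by
    have h1 := incr_diff H hL hZ hε hw hw2 hz hv hX dv dX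
    have e1 : (q - p) - (q' - p') = ((σ p v + A p X) - (σ p' v' + A p' X')) + (j - j') := by
      rw [hq, hq']; abel
    rw [e1]
    exact (norm_add_le _ _).trans (add_le_add h1 dj)
  have AX' : ‖A p' X'‖ ≤ B * (L * w ^ 2) :=
    ContinuousLinearMap.le_of_opNorm_le_of_le _ (H.An.bd p') hX'
  have AX : ‖A p X‖ ≤ B * (L * w ^ 2) :=
    ContinuousLinearMap.le_of_opNorm_le_of_le _ (H.An.bd p) hX
  have Rexp : ∀ {p q j : E} {v : V} {X : W}, q = p + σ p v + A p X + j →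
      σ q - σ p - S p (σ p v) = (σ q - σ p - S p (q - p)) + S p (A p X + j) := by
    intro p q j v X hq
    have e1 : q - p = σ p v + (A p X + j) := by rw [hq]; abel
    rw [e1, map_add]; abel
  have nR' : ‖σ q' - σ p' - S p' (σ p' v')‖ ≤ (B * Q ^ 2 + B ^ 2 * L + B * N₀) * w ^ 2 := by
    rw [Rexp hq']
    have h1 := H.G1 p' q'
    have h1' : B * ‖q' - p'‖ ^ 2 ≤ B * (Q * w) ^ 2 := by gcongr
    have h2 := ContinuousLinearMap.le_of_opNorm_le_of_le _ (H.Sb p')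
      ((norm_add_le _ _).trans (add_le_add AX' hj'))
    refine (norm_add_le _ _).trans ((add_le_add (h1.trans h1') h2).trans ?_)
    have t1 : B * N₀ * w ^ 3 ≤ B * N₀ * w ^ 2 := by gcongr
    linarith
  have dG : ‖(σ q - σ p - S p (q - p)) - (σ q' - σ p' - S p' (q' - p'))‖ ≤
      B * (e * (Q * w) ^ 2 + (Q * w + Q * w) * (2 * B * L * e * w + N * w ^ 3)) := by
    refine (H.G p q p' q').trans ?_
    have := hz.trans hZe
    gcongr
  have dAX : ‖(A p X + j) - (A p' X' + j')‖ ≤ 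
      (B * e * (L * w ^ 2) + B * (e * w ^ 2)) + N * w ^ 3 := by
    have e1 : (A p X + j) - (A p' X' + j') = (A p X - A p' X') + (j - j') := by abel
    rw [e1]
    refine (norm_add_le _ _).trans (add_le_add ?_ dj)
    exact clm_diff ((H.An.lip p p').trans (mul_le_mul_of_nonneg_left (hz.trans hZe)
      (by linarith))) hX (H.An.bd p') (dX.trans (by gcongr))
  have dS := clm_diff ((H.Sl p p').trans (mul_le_mul_of_nonneg_left (hz.trans hZe)
      (by linarith : (0:ℝ) ≤ B))) ((norm_add_le _ _).trans (add_le_add AX hj)) (H.Sb p') dAX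
  have dR : ‖(σ q - σ p - S p (σ p v)) - (σ q' - σ p' - S p' (σ p' v'))‖ ≤
      (B * (Q ^ 2 + 4 * Q * B * L) + 2 * B ^ 2 * L + B * N₀ + B ^ 2) * e * w ^ 2 
        + (2 * Q * B + B) * N * w ^ 3 := by
    rw [Rexp hq, Rexp hq', add_sub_add_comm]
    refine (norm_add_le _ _).trans ((add_le_add dG dS).trans ?_)
    have t1 : B * N₀ * e * w ^ 3 ≤ B * N₀ * e * w ^ 2 := by gcongr
    have t2 : 2 * Q * B * N * w ^ 4 ≤ 2 * Q * B * N * w ^ 3 := by gcongr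
    linarith
  have nA' : ‖A q' - A p'‖ ≤ B * (Q * w) :=
    (H.An.lip _ _).trans (by gcongr)
  have dA : ‖(A q - A p) - (A q' - A p')‖ ≤
      B * (e * (Q * w) + (2 * B * L * e * w + N * w ^ 3)) := by
    refine (H.An.sd p q p' q').trans ?_
    have := hz.trans hZe
    gcongr
  have f1 := clm_diff dR hu nR' (du.trans (mul_le_mul_of_nonneg_right hεe hw))
  have f2 := clm_diff dA hY nA' (dY.trans (mul_le_mul_of_nonneg_right hεe (by positivity)))
  unfold Theta
  rw [add_sub_add_comm]
  refine (norm_add_le _ _).trans ((add_le_add f1 f2).trans ?_)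
  have ha : 0 ≤ B * (Q ^ 2 + 4 * Q * B * L) + 2 * B ^ 2 * L + B * N₀ + B ^ 2 := by positivity
  have hc : 0 ≤ B * Q ^ 2 + B ^ 2 * L + B * N₀ := by positivity
  have hb : 0 ≤ 2 * Q * B + B := by positivity
  generalize B * (Q ^ 2 + 4 * Q * B * L) + 2 * B ^ 2 * L + B * N₀ + B ^ 2 = a at *
  generalize B * Q ^ 2 + B ^ 2 * L + B * N₀ = c at *
  generalize 2 * Q * B + B = b at *
  have t1 : B * L * N * w ^ 5 ≤ B * L * N * w ^ 4 := by gcongr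
  have t2 : 0 ≤ (a * L + c + (B * Q + 2 * B ^ 2 * L) * L + B * Q) * (N * w ^ 4) := by positivity
  have t3 : 0 ≤ (b * L + B * L) * (e * w ^ 3) := by positivity
  linarith
end static
end Ito

namespace Ito

/-- The dyadic contraction factor. -/
def rho (θ : ℝ) : ℝ := 2 * (1 / 2 : ℝ) ^ θ

theorem rho_pos (θ : ℝ) : 0 < rho θ := by unfold rho; positivity

theorem rho_lt {θ : ℝ} (h : 1 < θ) : rho θ < 1 := by
  have := Real.rpow_lt_rpow_of_exponent_gt (x := (1 / 2 : ℝ)) (by norm_num) (by norm_num) h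
  rw [Real.rpow_one] at this
  unfold rho; linarith

theorem exists_small {κ c C : ℝ} (hκ : 0 < κ) (hc : 0 < c) (hC : 0 ≤ C) :
    ∃ h : ℝ, 0 < h ∧ h ≤ 1 ∧ C * h ^ κ ≤ c := by
  have h0 : 0 < min 1 (c / (C + 1)) := lt_min one_pos (by positivity)
  refine ⟨(min 1 (c / (C + 1))) ^ (1 / κ), by positivity,
    Real.rpow_le_one h0.le (min_le_left _ _) (by positivity), ?_⟩
  rw [← Real.rpow_mul h0.le, one_div_mul_cancel hκ.ne', Real.rpow_one]
  calc C * min 1 (c / (C + 1)) ≤ (C + 1) * (c / (C + 1)) := by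
        gcongr
        · linarith
        · exact min_le_right _ _
    _ = c := by field_simp

section
variable {E : Type*} [NormedAddCommGroup E]

theorem sewing {θ : ℝ} (hθ : 1 < θ) {a b h M : ℝ} (hM : 0 ≤ M) (f : ℝ → ℝ → E)
    (step : ∀ N, 0 ≤ N →
      (∀ s t, a ≤ s → s ≤ t → t ≤ b → t - s ≤ h → ‖f s t‖ ≤ N * (t - s) ^ θ) →
      ∀ s u t, a ≤ s → s ≤ u → u ≤ t → t ≤ b → t - s ≤ h →
        ‖f s t - f s u - f u t‖ ≤ (M + (1 - rho θ) / 2 * N) * (t - s) ^ θ)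
    {N₀ : ℝ}
    (h0 : ∀ s t, a ≤ s → s ≤ t → t ≤ b → t - s ≤ h → ‖f s t‖ ≤ N₀ * (t - s) ^ θ) :
    ∀ s t, a ≤ s → s ≤ t → t ≤ b → t - s ≤ h →
      ‖f s t‖ ≤ M / ((1 - rho θ) / 2) * (t - s) ^ θ := by
  have hρ := rho_lt hθ
  have hρ0 := rho_pos θ
  let ι := {p : ℝ × ℝ // a ≤ p.1 ∧ p.1 ≤ p.2 ∧ p.2 ≤ b ∧ p.2 - p.1 ≤ h}
  have key := contraction (ι := ι) (fun p => ‖f p.1.1 p.1.2‖) (fun p => (p.1.2 - p.1.1) ^ θ)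
    (fun p => Real.rpow_nonneg (by linarith [p.2.2.1]) _) (r := rho θ + (1 - rho θ) / 2) (c := M)
    (by linarith) (by linarith) hM ?_ (N₀ := N₀)
    (fun p => h0 _ _ p.2.1 p.2.2.1 p.2.2.2.1 p.2.2.2.2)
  · intro s t h1 h2 h3 h4
    have := key ⟨(s, t), h1, h2, h3, h4⟩
    have e : 1 - (rho θ + (1 - rho θ) / 2) = (1 - rho θ) / 2 := by ring
    rwa [e] at this
  · intro N hN hf
    have hf' : ∀ s t, a ≤ s → s ≤ t → t ≤ b → t - s ≤ h → ‖f s t‖ ≤ N * (t - s) ^ θ :=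
      fun s t h1 h2 h3 h4 => hf ⟨(s, t), h1, h2, h3, h4⟩
    rintro ⟨⟨s, t⟩, h1, h2, h3, h4⟩
    simp only at h1 h2 h3 h4 ⊢
    have hs := step N hN hf' s ((s + t) / 2) t h1 (by linarith) (by linarith) h3 h4
    have a1 := hf' s ((s + t) / 2) h1 (by linarith) (by linarith) (by linarith)
    have a2 := hf' ((s + t) / 2) t (by linarith) (by linarith) h3 (by linarith)
    have e1 : (s + t) / 2 - s = 1 / 2 * (t - s) := by ring
    have e2 : t - (s + t) / 2 = 1 / 2 * (t - s) := by ring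
    rw [e1, Real.mul_rpow (by norm_num) (by linarith)] at a1
    rw [e2, Real.mul_rpow (by norm_num) (by linarith)] at a2
    have e3 : f s t = (f s t - f s ((s + t) / 2) - f ((s + t) / 2) t) + f s ((s + t) / 2)
      + f ((s + t) / 2) t := by abel
    rw [e3]
    refine norm_add₃_le.trans ((add_le_add (add_le_add hs a1) a2).trans (le_of_eq ?_))
    unfold rho; ring
end

section dyn
variable {E V W : Type*} [NormedAddCommGroup E] [NormedSpace ℝ E]
  [NormedAddCommGroup V] [NormedSpace ℝ V] [NormedAddCommGroup W] [NormedSpace ℝ W]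

/-- Remainder of the Davie expansion. -/
def Jf (σ : E → V →L[ℝ] E) (A : E → W →L[ℝ] E) (x : ℝ → V) (X : ℝ → ℝ → W) (y : ℝ → E)
    (s t : ℝ) : E := y t - y s - σ (y s) (x t - x s) - A (y s) (X s t)

/-- A solution of the (abstract) rough differential equation, with controlled driver. -/
structure Sol (σ : E → V →L[ℝ] E) (S : E → E →L[ℝ] V →L[ℝ] E) (A : E → W →L[ℝ] E)
    (κ γ T L : ℝ) (x : ℝ → V) (X : ℝ → ℝ → W) (y : ℝ → E) : Prop where
  hx : ∀ s t, 0 ≤ s → s ≤ t → t ≤ T → ‖x t - x s‖ ≤ L * (t - s) ^ γ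
  hX : ∀ s t, 0 ≤ s → s ≤ t → t ≤ T → ‖X s t‖ ≤ L * (t - s) ^ (2 * γ)
  chen : ∀ z s u t, 0 ≤ s → s ≤ u → u ≤ t → t ≤ T →
    A z (X s t) - A z (X s u) - A z (X u t) = S z (σ z (x u - x s)) (x t - x u)
  cont : ContinuousOn y (Icc 0 T)
  J : ∃ C, ∀ s t, 0 ≤ s → s ≤ t → t ≤ T → ‖Jf σ A x X y s t‖ ≤ C * (t - s) ^ (3 * κ)

variable {σ : E → V →L[ℝ] E} {S : E → E →L[ℝ] V →L[ℝ] E} {A : E → W →L[ℝ] E}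
  {κ γ T L B : ℝ} {x x' : ℝ → V} {X X' : ℝ → ℝ → W} {y y' : ℝ → E}

theorem Sol.delta (h : Sol σ S A κ γ T L x X y) {s u t : ℝ} (h0 : 0 ≤ s) (h1 : s ≤ u)
    (h2 : u ≤ t) (h3 : t ≤ T) :
    Jf σ A x X y s t - Jf σ A x X y s u - Jf σ A x X y u t =
      Theta σ S A (y s) (y u) (x u - x s) (x t - x u) (X u t) := by
  have hc := h.chen (y s) s u t h0 h1 h2 h3
  have e : x t - x s = (x u - x s) + (x t - x u) := by abel
  unfold Jf Theta
  rw [e, map_add]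
  simp only [sub_apply]
  rw [← hc]
  abel

theorem Jf_eq (s u : ℝ) : y u = y s + σ (y s) (x u - x s) + A (y s) (X s u) + Jf σ A x X y s u := by
  unfold Jf; abel

theorem pw (hκ : 0 < κ) {τ δ e : ℝ} (n : ℕ) (h0 : 0 ≤ τ) (h1 : τ ≤ δ) (h2 : δ ≤ 1)
    (he : n * κ ≤ e) : τ ^ e ≤ (δ ^ κ) ^ n := by
  have hn : (0:ℝ) ≤ n * κ := by positivity
  rw [← Real.rpow_mul_natCast (h0.trans h1), mul_comm κ]
  exact (Real.rpow_le_rpow h0 h1 (hn.trans he)).trans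
    (Real.rpow_le_rpow_of_exponent_ge' (h0.trans h1) h2 hn he)

theorem apriori (H : Coef σ S A B) (hκ : 1 / 3 < κ) (hκγ : κ < γ) (hL : 1 ≤ L) (T : ℝ) :
    ∃ h N₀ : ℝ, 0 < h ∧ h ≤ 1 ∧ 0 ≤ N₀ ∧ ∀ (x : ℝ → V) (X : ℝ → ℝ → W) (y : ℝ → E),
      Sol σ S A κ γ T L x X y → ∀ s t, 0 ≤ s → s ≤ t → t ≤ T → t - s ≤ h →
        ‖Jf σ A x X y s t‖ ≤ N₀ * (t - s) ^ (3 * κ) := by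
  have hB := H.one
  have hθ : 1 < 3 * κ := by linarith
  have hκ0 : 0 < κ := by linarith
  have hρ := rho_lt hθ
  set C := 4*B^3*L^3 + 3*B^2*L^2 + 2*B*L with hC
  have hC0 : 0 ≤ C := by positivity
  obtain ⟨h, hh0, hh1, hh⟩ := exists_small hκ0 (c := (1 - rho (3 * κ)) / 2) (by linarith) hC0
  refine ⟨h, C / ((1 - rho (3 * κ)) / 2), hh0, hh1, div_nonneg hC0 (by linarith), ?_⟩
  intro x X y hs
  obtain ⟨C₀, hC₀⟩ := hs.J
  refine sewing hθ hC0 (Jf σ A x X y) ?_ (fun s t h1 h2 h3 _ => hC₀ s t h1 h2 h3)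
  intro N hN hf s u t h1 h2 h3 h4 h5
  rw [hs.delta h1 h2 h3 h4]
  have hst : 0 ≤ t - s := by linarith
  have hw : 0 ≤ (t - s) ^ κ := Real.rpow_nonneg hst _
  have hw1 : (t - s) ^ κ ≤ 1 := Real.rpow_le_one hst (by linarith) hκ0.le
  have hL0 : 0 ≤ L := by linarith
  have key := Theta_bound H hL hN hw hw1 (Jf_eq (σ := σ) (A := A) (x := x) (X := X) (y := y) s u)
    (v' := x t - x u) (X' := X u t)
    ((hs.hx s u h1 h2 (by linarith)).trans (mul_le_mul_of_nonneg_left (by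
      simpa using pw hκ0 1 (by linarith) (by linarith : u - s ≤ t - s) (by linarith) (by
        push_cast; linarith)) hL0))
    ((hs.hx u t (by linarith) h3 (by linarith)).trans (mul_le_mul_of_nonneg_left (by
      simpa using pw hκ0 1 (by linarith) (by linarith : t - u ≤ t - s) (by linarith) (by
        push_cast; linarith)) hL0))
    ((hs.hX s u h1 h2 (by linarith)).trans (mul_le_mul_of_nonneg_left (
      pw hκ0 2 (by linarith) (by linarith : u - s ≤ t - s) (by linarith) (by
        push_cast; linarith)) hL0))
    ((hs.hX u t (by linarith) h3 (by linarith)).trans (mul_le_mul_of_nonneg_left (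
      pw hκ0 2 (by linarith) (by linarith : t - u ≤ t - s) (by linarith) (by
        push_cast; linarith)) hL0))
    ((hf s u h1 h2 (by linarith) (by linarith)).trans (mul_le_mul_of_nonneg_left (
      pw hκ0 3 (by linarith) (by linarith : u - s ≤ t - s) (by linarith) (by
        push_cast; linarith)) hN))
  refine key.trans ?_
  have e : ((t - s) ^ κ) ^ 3 = (t - s) ^ (3 * κ) := by
    rw [← Real.rpow_mul_natCast hst, mul_comm κ]; norm_num
  rw [e]
  refine mul_le_mul_of_nonneg_right ?_ (Real.rpow_nonneg hst _)
  have h6 : C * (t - s) ^ κ ≤ (1 - rho (3 * κ)) / 2 := by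
    refine le_trans ?_ hh
    gcongr
  nlinarith

theorem diff_local (H : Coef σ S A B) (hκ : 1 / 3 < κ) (hκγ : κ < γ) (hγ : γ ≤ 1) (hL : 1 ≤ L)
    (T : ℝ) :
    ∃ h C₃ : ℝ, 0 < h ∧ h ≤ 1 ∧ 0 ≤ C₃ ∧ ∀ (x x' : ℝ → V) (X X' : ℝ → ℝ → W) (y y' : ℝ → E) (ε : ℝ),
      0 ≤ ε → Sol σ S A κ γ T L x X y → Sol σ S A κ γ T L x' X' y' →
      (∀ s t, 0 ≤ s → s ≤ t → t ≤ T → ‖(x t - x s) - (x' t - x' s)‖ ≤ ε * (t - s) ^ γ) →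
      (∀ s t, 0 ≤ s → s ≤ t → t ≤ T → ‖X s t - X' s t‖ ≤ ε * (t - s) ^ (2 * γ)) →
      ∀ a b Z, 0 ≤ a → b ≤ T → b ≤ a + h → 0 ≤ Z → (∀ t, a ≤ t → t ≤ b → ‖y t - y' t‖ ≤ Z) →
      ∀ s t, a ≤ s → s ≤ t → t ≤ b →
        ‖(y t - y' t) - (y s - y' s)‖ ≤ C₃ * (Z + ε) * (t - s) ^ γ := by
  have hB := H.one
  have hθ : 1 < 3 * κ := by linarith
  have hκ0 : 0 < κ := by linarith
  have hL0 : 0 ≤ L := by linarith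
  have hρ := rho_lt hθ
  obtain ⟨h₁, N₀, hh₁0, hh₁1, hN₀, hap⟩ := apriori H hκ hκγ hL T
  set C := C2 B L N₀ with hC
  have hC0 : 0 ≤ C := by rw [hC]; unfold C2; positivity
  obtain ⟨h₂, hh₂0, hh₂1, hh₂⟩ := exists_small hκ0 (c := (1 - rho (3 * κ)) / 2) (by linarith) hC0
  have hD0 : 0 ≤ C / ((1 - rho (3 * κ)) / 2) := div_nonneg hC0 (by linarith)
  refine ⟨min h₁ h₂, 2 * B * L + C / ((1 - rho (3 * κ)) / 2), lt_min hh₁0 hh₂0,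
    (min_le_left _ _).trans hh₁1, by positivity, ?_⟩
  intro x x' X X' y y' ε hε hs hs' dx dX a b Z ha hbT hb hZ hz
  have hb1 : b ≤ a + h₁ := hb.trans (by gcongr; exact min_le_left _ _)
  have hb2 : b ≤ a + h₂ := hb.trans (by gcongr; exact min_le_right _ _)
  obtain ⟨C₀, hC₀⟩ := hs.J
  obtain ⟨C₀', hC₀'⟩ := hs'.J
  have hD : ∀ s t, a ≤ s → s ≤ t → t ≤ b → t - s ≤ b - a →
      ‖Jf σ A x X y s t - Jf σ A x' X' y' s t‖ ≤
        C * (Z + ε) / ((1 - rho (3 * κ)) / 2) * (t - s) ^ (3 * κ) := by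
    refine sewing hθ (by positivity) (fun s t => Jf σ A x X y s t - Jf σ A x' X' y' s t) ?_
      (N₀ := C₀ + C₀') (fun s t h1 h2 h3 _ => ?_)
    · intro N hN hf s u t h1 h2 h3 h4 h5
      have h0s : 0 ≤ s := ha.trans h1
      have htT : t ≤ T := h4.trans hbT
      have e0 : (Jf σ A x X y s t - Jf σ A x' X' y' s t) - (Jf σ A x X y s u - Jf σ A x' X' y' s u)
          - (Jf σ A x X y u t - Jf σ A x' X' y' u t) =
          (Jf σ A x X y s t - Jf σ A x X y s u - Jf σ A x X y u t) -
          (Jf σ A x' X' y' s t - Jf σ A x' X' y' s u - Jf σ A x' X' y' u t) := by abel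
      rw [e0, hs.delta h0s h2 h3 htT, hs'.delta h0s h2 h3 htT]
      have hst : 0 ≤ t - s := by linarith
      have hw : 0 ≤ (t - s) ^ κ := Real.rpow_nonneg hst _
      have hw1 : (t - s) ^ κ ≤ 1 := Real.rpow_le_one hst (by linarith) hκ0.le
      have p1 : (u - s) ^ γ ≤ (t - s) ^ κ := by
        simpa using pw hκ0 1 (by linarith) (by linarith : u - s ≤ t - s) (by linarith) (by
          push_cast; linarith : ((1 : ℕ) : ℝ) * κ ≤ γ)
      have p1' : (t - u) ^ γ ≤ (t - s) ^ κ := by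
        simpa using pw hκ0 1 (by linarith) (by linarith : t - u ≤ t - s) (by linarith) (by
          push_cast; linarith : ((1 : ℕ) : ℝ) * κ ≤ γ)
      have p2 : (u - s) ^ (2 * γ) ≤ ((t - s) ^ κ) ^ 2 :=
        pw hκ0 2 (by linarith) (by linarith) (by linarith) (by push_cast; linarith)
      have p2' : (t - u) ^ (2 * γ) ≤ ((t - s) ^ κ) ^ 2 :=
        pw hκ0 2 (by linarith) (by linarith) (by linarith) (by push_cast; linarith)
      have p3 : (u - s) ^ (3 * κ) ≤ ((t - s) ^ κ) ^ 3 :=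
        pw hκ0 3 (by linarith) (by linarith) (by linarith) (by push_cast; linarith)
      have hu0 : 0 ≤ u := by linarith
      have huT : u ≤ T := by linarith
      have key := Theta_diff H hL hN hN₀ hZ hε hw hw1
        (Jf_eq (σ := σ) (A := A) (x := x) (X := X) (y := y) s u)
        (Jf_eq (σ := σ) (A := A) (x := x') (X := X') (y := y') s u)
        (u := x t - x u) (u' := x' t - x' u) (Y := X u t) (Y' := X' u t)
        ((hs.hx s u h0s h2 huT).trans (mul_le_mul_of_nonneg_left p1 hL0))
        ((hs.hx u t hu0 h3 htT).trans (mul_le_mul_of_nonneg_left p1' hL0))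
        ((hs.hX s u h0s h2 huT).trans (mul_le_mul_of_nonneg_left p2 hL0))
        ((hs.hX u t hu0 h3 htT).trans (mul_le_mul_of_nonneg_left p2' hL0))
        ((hap x X y hs s u h0s h2 huT (by linarith)).trans (mul_le_mul_of_nonneg_left p3 hN₀))
        ((hs'.hx s u h0s h2 huT).trans (mul_le_mul_of_nonneg_left p1 hL0))
        ((hs'.hX s u h0s h2 huT).trans (mul_le_mul_of_nonneg_left p2 hL0))
        ((hap x' X' y' hs' s u h0s h2 huT (by linarith)).trans (mul_le_mul_of_nonneg_left p3 hN₀))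
        ((dx s u h0s h2 huT).trans (mul_le_mul_of_nonneg_left p1 hε))
        ((dx u t hu0 h3 htT).trans (mul_le_mul_of_nonneg_left p1' hε))
        ((dX s u h0s h2 huT).trans (mul_le_mul_of_nonneg_left p2 hε))
        ((dX u t hu0 h3 htT).trans (mul_le_mul_of_nonneg_left p2' hε))
        ((hf s u h1 h2 (by linarith) (by linarith)).trans (mul_le_mul_of_nonneg_left p3 hN))
        (hz s h1 (by linarith))
      refine key.trans ?_
      have e : ((t - s) ^ κ) ^ 3 = (t - s) ^ (3 * κ) := by
        rw [← Real.rpow_mul_natCast hst, mul_comm κ]; norm_num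
      rw [e]
      refine mul_le_mul_of_nonneg_right ?_ (Real.rpow_nonneg hst _)
      have h6 : C * (t - s) ^ κ ≤ (1 - rho (3 * κ)) / 2 := by
        refine le_trans ?_ hh₂
        gcongr
        linarith
      have h7 := mul_le_mul_of_nonneg_right h6 hN
      rw [← hC]
      linarith
    · refine (norm_sub_le _ _).trans ?_
      rw [add_mul]
      exact add_le_add (hC₀ s t (ha.trans h1) h2 (h3.trans hbT))
        (hC₀' s t (ha.trans h1) h2 (h3.trans hbT))
  intro s t h1 h2 h3
  have h0s : 0 ≤ s := ha.trans h1
  have htT : t ≤ T := h3.trans hbT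
  have hst : 0 ≤ t - s := by linarith
  have hst1 : t - s ≤ 1 := by linarith
  have q1 : (t - s) ^ (2 * γ) ≤ (t - s) ^ γ :=
    Real.rpow_le_rpow_of_exponent_ge' hst hst1 (by linarith) (by linarith)
  have q2 : (t - s) ^ (3 * κ) ≤ (t - s) ^ γ :=
    Real.rpow_le_rpow_of_exponent_ge' hst hst1 (by linarith) (by linarith)
  have k1 := incr_diff H hL hZ hε (Real.rpow_nonneg hst γ) q1 (hz s h1 (by linarith))
    (hs.hx s t h0s h2 htT) (hs.hX s t h0s h2 htT) (dx s t h0s h2 htT) (dX s t h0s h2 htT)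
  have k2 := hD s t h1 h2 h3 (by linarith)
  have e : (y t - y' t) - (y s - y' s) =
    ((σ (y s) (x t - x s) + A (y s) (X s t)) - (σ (y' s) (x' t - x' s) + A (y' s) (X' s t))) +
      (Jf σ A x X y s t - Jf σ A x' X' y' s t) := by
    unfold Jf; abel
  rw [e]
  refine (norm_add_le _ _).trans ((add_le_add k1 k2).trans ?_)
  have k3 : C * (Z + ε) / ((1 - rho (3 * κ)) / 2) * (t - s) ^ (3 * κ) ≤
      C * (Z + ε) / ((1 - rho (3 * κ)) / 2) * (t - s) ^ γ := by
    refine mul_le_mul_of_nonneg_left q2 (div_nonneg (by positivity) (by linarith))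
  refine (add_le_add_right k3 _).trans (le_of_eq ?_)
  ring

theorem core (H : Coef σ S A B) (hκ : 1 / 3 < κ) (hκγ : κ < γ) (hγ : γ ≤ 1) (hL : 1 ≤ L)
    (hT : 0 < T) :
    ∃ F : ℝ, 0 ≤ F ∧ ∀ (x x' : ℝ → V) (X X' : ℝ → ℝ → W) (y y' : ℝ → E) (ε : ℝ),
      0 ≤ ε → Sol σ S A κ γ T L x X y → Sol σ S A κ γ T L x' X' y' →
      (∀ s t, 0 ≤ s → s ≤ t → t ≤ T → ‖(x t - x s) - (x' t - x' s)‖ ≤ ε * (t - s) ^ γ) →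
      (∀ s t, 0 ≤ s → s ≤ t → t ≤ T → ‖X s t - X' s t‖ ≤ ε * (t - s) ^ (2 * γ)) →
      ‖y 0 - y' 0‖ ≤ ε →
      (∀ t, 0 ≤ t → t ≤ T → ‖y t - y' t‖ ≤ F * ε) ∧
      ∀ s t, 0 ≤ s → s ≤ t → t ≤ T →
        ‖(y t - y' t) - (y s - y' s)‖ ≤ F * ε * (t - s) ^ γ := by
  have hγ0 : 0 < γ := by linarith
  obtain ⟨h₁, C, hh₁0, hh₁1, hC, hloc⟩ := diff_local H hκ hκγ hγ hL T
  obtain ⟨h₂, hh₂0, hh₂1, hh₂⟩ := exists_small hγ0 (c := 1 / 2) (by norm_num) hC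
  set h := min h₁ h₂ with hh
  have h0 : 0 < h := lt_min hh₁0 hh₂0
  have hle1 : h ≤ h₁ := min_le_left _ _
  have hle2 : h ≤ h₂ := min_le_right _ _
  obtain ⟨n, hn⟩ := exists_nat_ge (T / h)
  have hn' : T ≤ n * h := by rwa [div_le_iff₀ h0] at hn
  have hhγ : 0 < h ^ γ := by positivity
  refine ⟨3 ^ n + C * (3 ^ n + 1) + 2 * 3 ^ n / h ^ γ, by positivity, ?_⟩
  intro x x' X X' y y' ε hε hs hs' dx dX hini
  have hstep : ∀ a b, 0 ≤ a → b ≤ T → b ≤ a + h → ∀ t, a ≤ t → t ≤ b →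
      ‖y t - y' t‖ ≤ 2 * ‖y a - y' a‖ + ε := by
    intro a b ha hbT hb
    have hcont : ContinuousOn (fun t => y t - y' t) (Icc a b) :=
      (hs.cont.sub hs'.cont).mono (Icc_subset_Icc ha hbT)
    obtain ⟨Z₀, hZ₀⟩ := isCompact_Icc.exists_bound_of_continuousOn hcont
    have key := contraction (ι := Icc a b) (fun t => ‖y t - y' t‖) (fun _ => 1)
      (fun _ => zero_le_one) (r := 1 / 2) (c := ‖y a - y' a‖ + ε / 2) (by norm_num) (by norm_num)
      (by positivity) ?_ (N₀ := Z₀) (fun t => by simpa using hZ₀ t t.2)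
    · intro t h1 h2
      have := key ⟨t, h1, h2⟩
      exact this.trans (le_of_eq (by ring))
    · rintro Z hZ hz ⟨t, h1, h2⟩
      have hz' : ∀ t, a ≤ t → t ≤ b → ‖y t - y' t‖ ≤ Z := fun t h1 h2 => by
        simpa using hz ⟨t, h1, h2⟩
      have k := hloc x x' X X' y y' ε hε hs hs' dx dX a b Z ha hbT (by linarith) hZ hz' a t
        le_rfl h1 h2
      have k2 : C * (t - a) ^ γ ≤ 1 / 2 := by
        refine le_trans ?_ hh₂
        have : 0 ≤ t - a := by linarith
        gcongr
        linarith
      have k3 := mul_le_mul_of_nonneg_right k2 (add_nonneg hZ hε)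
      have k4 : ‖y t - y' t‖ ≤ ‖(y t - y' t) - (y a - y' a)‖ + ‖y a - y' a‖ := by
        simpa using norm_add_le ((y t - y' t) - (y a - y' a)) (y a - y' a)
      simp only
      linarith
  have hind : ∀ k : ℕ, ∀ t, 0 ≤ t → t ≤ T → t ≤ k * h → ‖y t - y' t‖ ≤ 3 ^ k * ε := by
    intro k
    induction k with
    | zero =>
      intro t h1 _ h2
      have : t = 0 := by simp at h2; linarith
      subst this; simpa using hini
    | succ k ih =>
      intro t h1 h2 h3
      have h3k : (1 : ℝ) ≤ 3 ^ k := one_le_pow₀ (by norm_num)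
      have hk : ε ≤ 3 ^ k * ε := le_mul_of_one_le_left hε h3k
      rw [pow_succ]
      rcases le_total t (k * h) with h4 | h4
      · have := ih t h1 h2 h4
        linarith
      · have hkh : 0 ≤ k * h := by positivity
        have a1 := ih (k * h) hkh (by linarith) le_rfl
        have a2 := hstep (k * h) t hkh h2 (by push_cast at h3; linarith) t h4 le_rfl
        linarith
  have hsup : ∀ t, 0 ≤ t → t ≤ T → ‖y t - y' t‖ ≤ 3 ^ n * ε :=
    fun t h1 h2 => hind n t h1 h2 (h2.trans hn')
  have e1 : 0 ≤ C * (3 ^ n + 1) * ε := by positivity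
  have e2 : 0 ≤ 2 * 3 ^ n / h ^ γ * ε := by positivity
  have e3 : 0 ≤ 3 ^ n * ε := by positivity
  refine ⟨fun t h1 h2 => (hsup t h1 h2).trans (by linarith), fun s t h1 h2 h3 => ?_⟩
  have hst : 0 ≤ t - s := by linarith
  have hp := Real.rpow_nonneg hst γ
  rcases le_total (t - s) h with h4 | h4
  · have k := hloc x x' X X' y y' ε hε hs hs' dx dX s t (3 ^ n * ε) h1 h3 (by linarith) e3
      (fun r hr hr' => hsup r (by linarith) (by linarith)) s t le_rfl h2 le_rfl
    refine k.trans (mul_le_mul_of_nonneg_right ?_ hp)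
    linarith
  · have k : ‖(y t - y' t) - (y s - y' s)‖ ≤ 3 ^ n * ε + 3 ^ n * ε :=
      (norm_sub_le _ _).trans (add_le_add (hsup t (by linarith) h3) (hsup s h1 (by linarith)))
    have k2 : h ^ γ ≤ (t - s) ^ γ := Real.rpow_le_rpow h0.le h4 hγ0.le
    have k3 : 2 * 3 ^ n / h ^ γ * ε * h ^ γ ≤ 2 * 3 ^ n / h ^ γ * ε * (t - s) ^ γ := by gcongr
    have k4 : 2 * 3 ^ n / h ^ γ * ε * h ^ γ = 2 * 3 ^ n * ε := by field_simp
    have k5 : 0 ≤ (3 ^ n + C * (3 ^ n + 1)) * ε * (t - s) ^ γ := by positivity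
    linarith

end dyn
end Ito

namespace Ito

theorem holder_bound {E : Type*} [NormedAddCommGroup E] {γ a b : ℝ} {f : ℝ → E}
    (hf : holderENorm γ a b f < ⊤) {s t : ℝ} (h1 : a ≤ s) (h2 : s ≤ t) (h3 : t ≤ b) :
    ‖f t - f s‖ ≤ (holderENorm γ a b f).toReal * (t - s) ^ γ := by
  rcases h2.eq_or_lt with h | h
  · subst h
    simp only [sub_self, norm_zero]
    exact mul_nonneg ENNReal.toReal_nonneg (Real.rpow_nonneg le_rfl _)
  · have hp : 0 < (t - s) ^ γ := Real.rpow_pos_of_pos (by linarith) _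
    rw [← div_le_iff₀ hp]
    rw [← ENNReal.ofReal_le_iff_le_toReal hf.ne]
    exact le_iSup (fun p : {p : ℝ × ℝ // a ≤ p.1 ∧ p.1 < p.2 ∧ p.2 ≤ b} =>
      ENNReal.ofReal (‖f p.1.2 - f p.1.1‖ / (p.1.2 - p.1.1) ^ γ)) ⟨(s, t), h1, h, h3⟩

theorem holder2_bound {E : Type*} [NormedAddCommGroup E] {γ a b : ℝ} {f : ℝ → ℝ → E}
    (hf : holder2ENorm γ a b f < ⊤) (hd : ∀ s, a ≤ s → s ≤ b → f s s = 0)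
    {s t : ℝ} (h1 : a ≤ s) (h2 : s ≤ t) (h3 : t ≤ b) :
    ‖f s t‖ ≤ (holder2ENorm γ a b f).toReal * (t - s) ^ γ := by
  rcases h2.eq_or_lt with h | h
  · subst h
    rw [hd s h1 h3, norm_zero, sub_self]
    exact mul_nonneg ENNReal.toReal_nonneg (Real.rpow_nonneg le_rfl _)
  · have hp : 0 < (t - s) ^ γ := Real.rpow_pos_of_pos (by linarith) _
    rw [← div_le_iff₀ hp]
    rw [← ENNReal.ofReal_le_iff_le_toReal hf.ne]
    exact le_iSup (fun p : {p : ℝ × ℝ // a ≤ p.1 ∧ p.1 < p.2 ∧ p.2 ≤ b} =>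
      ENNReal.ofReal (‖f p.1.1 p.1.2‖ / (p.1.2 - p.1.1) ^ γ)) ⟨(s, t), h1, h, h3⟩

theorem holder_le {E : Type*} [NormedAddCommGroup E] {γ a b C : ℝ} {f : ℝ → E}
    (h : ∀ s t, a ≤ s → s ≤ t → t ≤ b → ‖f t - f s‖ ≤ C * (t - s) ^ γ) :
    holderENorm γ a b f ≤ ENNReal.ofReal C := by
  refine iSup_le ?_
  rintro ⟨⟨s, t⟩, h1, h2, h3⟩
  have hp : 0 < (t - s) ^ γ := Real.rpow_pos_of_pos (by simpa using h2) _
  refine ENNReal.ofReal_le_ofReal ?_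
  rw [div_le_iff₀ hp]
  exact h s t h1 h2.le h3

theorem holder2_le {E : Type*} [NormedAddCommGroup E] {γ a b C : ℝ} {f : ℝ → ℝ → E}
    (h : ∀ s t, a ≤ s → s ≤ t → t ≤ b → ‖f s t‖ ≤ C * (t - s) ^ γ) :
    holder2ENorm γ a b f ≤ ENNReal.ofReal C := by
  refine iSup_le ?_
  rintro ⟨⟨s, t⟩, h1, h2, h3⟩
  have hp : 0 < (t - s) ^ γ := Real.rpow_pos_of_pos (by simpa using h2) _
  refine ENNReal.ofReal_le_ofReal ?_
  rw [div_le_iff₀ hp]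
  exact h s t h1 h2.le h3

theorem sup_le {E : Type*} [NormedAddCommGroup E] {a b C : ℝ} {f : ℝ → E}
    (h : ∀ t, a ≤ t → t ≤ b → ‖f t‖ ≤ C) : supENorm a b f ≤ ENNReal.ofReal C :=
  iSup_le fun t => ENNReal.ofReal_le_ofReal (h t t.2.1 t.2.2)

theorem holder_le_infty {E : Type*} [NormedAddCommGroup E] {γ T : ℝ} (hγ : 0 ≤ γ) {f : ℝ → E}
    (hf : holderENorm γ 0 T f < ⊤) : (holderENorm γ 0 T f).toReal ≤ holderInftyNorm γ 0 T f := by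
  have hs : supENorm 0 T f < ⊤ := by
    refine (sup_le (C := (holderENorm γ 0 T f).toReal * T ^ γ + ‖f 0‖) ?_).trans_lt
      ENNReal.ofReal_lt_top
    intro t h1 h2
    have h3 := holder_bound hf le_rfl h1 h2
    have h4 : ‖f t‖ ≤ ‖f t - f 0‖ + ‖f 0‖ := by simpa using norm_add_le (f t - f 0) (f 0)
    rw [sub_zero] at h3
    have h5 : (holderENorm γ 0 T f).toReal * t ^ γ ≤ (holderENorm γ 0 T f).toReal * T ^ γ :=
      mul_le_mul_of_nonneg_left (Real.rpow_le_rpow h1 h2 hγ) ENNReal.toReal_nonneg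
    linarith
  exact ENNReal.toReal_mono (ENNReal.add_lt_top.2 ⟨hs, hf⟩).ne le_add_self

theorem diag_zero {m : ℕ} {γ a b : ℝ} {x : ℝ → Vec m} {X : ℝ → ℝ → Mat m}
    (h : IsRoughPath m γ a b x X) (s : ℝ) (h1 : a ≤ s) (h2 : s ≤ b) : X s s = 0 := by
  ext ⟨i, j⟩
  have := h.2.2.2 s s s h1 le_rfl le_rfl h2 i j
  simp at this ⊢
  exact this

/-- The map that turns `Dσ σ` into the operator acting on the second level. -/
def Lam (d m : ℕ) : (Vec m →L[ℝ] Vec m →L[ℝ] Vec d) →L[ℝ] (Mat m →L[ℝ] Vec d) :=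
  ∑ i : Fin m, ∑ j : Fin m,
    (ContinuousLinearMap.smulRightL ℝ (Mat m) (Vec d)
      (EuclideanSpace.proj (i, j) : Mat m →L[ℝ] ℝ)).comp
    ((ContinuousLinearMap.apply ℝ (Vec d) (EuclideanSpace.single j (1 : ℝ))).comp
      (ContinuousLinearMap.apply ℝ (Vec m →L[ℝ] Vec d) (EuclideanSpace.single i (1 : ℝ))))

theorem Lam_apply {d m : ℕ} (P : Vec m →L[ℝ] Vec m →L[ℝ] Vec d) (X : Mat m) :
    Lam d m P X = ∑ i : Fin m, ∑ j : Fin m, X (i, j) •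
      P (EuclideanSpace.single i (1 : ℝ)) (EuclideanSpace.single j (1 : ℝ)) := by
  simp [Lam]

theorem vec_exp {m : ℕ} (v : Vec m) : v = ∑ i, v i • EuclideanSpace.single i (1 : ℝ) := by
  ext k
  simp [Finset.sum_apply, Pi.single_apply]

theorem bil_exp {d m : ℕ} (P : Vec m →L[ℝ] Vec m →L[ℝ] Vec d) (v w : Vec m) :
    P v w = ∑ i : Fin m, ∑ j : Fin m, (v i * w j) •
      P (EuclideanSpace.single i (1 : ℝ)) (EuclideanSpace.single j (1 : ℝ)) := by
  conv_lhs => rw [vec_exp v, vec_exp w]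
  simp only [map_sum, map_smul, sum_apply, smul_apply,
    Finset.smul_sum, smul_smul]
  rw [Finset.sum_comm]
  refine Finset.sum_congr rfl fun i _ => Finset.sum_congr rfl fun j _ => ?_
  rw [mul_comm]

/-- The second-level coefficient. -/
def Aop (d m : ℕ) (σ : Vec d → Vec m →L[ℝ] Vec d) (z : Vec d) : Mat m →L[ℝ] Vec d :=
  Lam d m (ContinuousLinearMap.compL ℝ (Vec m) (Vec d) (Vec m →L[ℝ] Vec d) (fderiv ℝ σ z) (σ z))

theorem lip_of_C1 {E F : Type*} [NormedAddCommGroup E] [NormedSpace ℝ E]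
    [NormedAddCommGroup F] [NormedSpace ℝ F] {f : E → F} {B : ℝ} (hf : ContDiff ℝ 1 f)
    (hb : ∀ z, ‖iteratedFDeriv ℝ 1 f z‖ ≤ B) (p q : E) : ‖f p - f q‖ ≤ B * ‖p - q‖ :=
  convex_univ.norm_image_sub_le_of_norm_fderiv_le
    (fun z _ => hf.differentiable (by norm_num) z)
    (fun z _ => by rw [← norm_iteratedFDeriv_one]; exact hb z) (mem_univ q) (mem_univ p)

theorem nice_comp {E V G : Type*} [NormedAddCommGroup E] [NormedSpace ℝ E]
    [NormedAddCommGroup V] [NormedSpace ℝ V] [NormedAddCommGroup G] [NormedSpace ℝ G]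
    {σ : E → V →L[ℝ] E} {S : E → E →L[ℝ] V →L[ℝ] E} {M : ℝ} (h0 : Nice σ M) (h1 : Nice S M)
    (Λ : (V →L[ℝ] V →L[ℝ] E) →L[ℝ] G) :
    ∃ R, Nice (fun z => Λ (ContinuousLinearMap.compL ℝ V E (V →L[ℝ] E) (S z) (σ z))) R := by
  have hb := Nice.bilin (F := E →L[ℝ] V →L[ℝ] E) (G := V →L[ℝ] E) (H := V →L[ℝ] V →L[ℝ] E)
    h1 h0 (ContinuousLinearMap.compL ℝ V E (V →L[ℝ] E))
  have hc := Nice.clm (F := V →L[ℝ] V →L[ℝ] E) (G := G) hb Λ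
  exact ⟨_, hc⟩

theorem nice_of_C3 {E F : Type*} [NormedAddCommGroup E] [NormedSpace ℝ E]
    [NormedAddCommGroup F] [NormedSpace ℝ F] {σ : E → F} (hσ : IsC3Bounded σ) :
    ∃ M, Nice σ M ∧ Nice (fderiv ℝ σ) M := by
  obtain ⟨hc, hb⟩ := hσ
  obtain ⟨B0, h0⟩ := hb 0 (by norm_num)
  obtain ⟨B1, h1⟩ := hb 1 (by norm_num)
  obtain ⟨B2, h2⟩ := hb 2 (by norm_num)
  obtain ⟨B3, h3⟩ := hb 3 (by norm_num)
  have c1 : ContDiff ℝ 2 (fderiv ℝ σ) := hc.fderiv_right (by norm_num)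
  have c2 : ContDiff ℝ 1 (fderiv ℝ (fderiv ℝ σ)) := c1.fderiv_right (by norm_num)
  have d0 : ∀ z, HasFDerivAt σ (fderiv ℝ σ z) z := fun z =>
    (hc.differentiable (by norm_num) z).hasFDerivAt
  have d1 : ∀ z, HasFDerivAt (fderiv ℝ σ) (fderiv ℝ (fderiv ℝ σ) z) z := fun z =>
    (c1.differentiable (by norm_num) z).hasFDerivAt
  have b0 : ∀ z, ‖σ z‖ ≤ B0 := fun z => by simpa using h0 z
  have b1 : ∀ z, ‖fderiv ℝ σ z‖ ≤ B1 := fun z => by simpa [norm_iteratedFDeriv_one] using h1 z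
  have b2 : ∀ z, ‖fderiv ℝ (fderiv ℝ σ) z‖ ≤ B2 := fun z => by
    have := h2 z
    rwa [← norm_iteratedFDeriv_fderiv, norm_iteratedFDeriv_one] at this
  have b3 : ∀ z, ‖iteratedFDeriv ℝ 1 (fderiv ℝ (fderiv ℝ σ)) z‖ ≤ B3 := fun z => by
    rw [norm_iteratedFDeriv_fderiv, norm_iteratedFDeriv_fderiv]; exact h3 z
  set M := max (max B0 B1) (max B2 B3) with hM
  have m0 : B0 ≤ M := (le_max_left _ _).trans (le_max_left _ _)
  have m1 : B1 ≤ M := (le_max_right _ _).trans (le_max_left _ _)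
  have m2 : B2 ≤ M := (le_max_left _ _).trans (le_max_right _ _)
  have m3 : B3 ≤ M := (le_max_right _ _).trans (le_max_right _ _)
  have l1 : ∀ p q, ‖fderiv ℝ σ p - fderiv ℝ σ q‖ ≤ M * ‖p - q‖ :=
    lip_of_C1 (c1.of_le (by norm_num)) (fun z => by
      rw [norm_iteratedFDeriv_fderiv]; exact (h2 z).trans m2)
  have l2 : ∀ p q, ‖fderiv ℝ (fderiv ℝ σ) p - fderiv ℝ (fderiv ℝ σ) q‖ ≤ M * ‖p - q‖ :=
    lip_of_C1 c2 (fun z => (b3 z).trans m3)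
  have n0 : Nice σ M :=
    nice_of_deriv d0 (fun z => (b0 z).trans m0) (fun z => (b1 z).trans m1) l1
  have n1 : Nice (fderiv ℝ σ) M :=
    nice_of_deriv d1 (fun z => (b1 z).trans m1) (fun z => (b2 z).trans m2) l2
  exact ⟨M, n0, n1⟩

theorem coef_of_C3 {d m : ℕ} {σ : Vec d → Vec m →L[ℝ] Vec d} (hσ : IsC3Bounded σ) :
    ∃ B, Coef σ (fderiv ℝ σ) (Aop d m σ) B := by
  obtain ⟨M, n0, n1⟩ := nice_of_C3 hσ
  have d0 : ∀ z, HasFDerivAt σ (fderiv ℝ σ z) z := fun z =>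
    (hσ.1.differentiable (by norm_num) z).hasFDerivAt
  obtain ⟨R, nA⟩ := nice_comp n0 n1 (Lam d m)
  have k0 : M ≤ max 1 (max M R) := (le_max_left _ _).trans (le_max_right _ _)
  have k1 : R ≤ max 1 (max M R) := (le_max_right _ _).trans (le_max_right _ _)
  have n0' := n0.mono k0
  have n1' := n1.mono k0
  refine ⟨max 1 (max M R), le_max_left _ _, n0'.bd, n0'.lip, n1'.bd, n1'.lip, ?_, nA.mono k1⟩
  intro p q p' q'
  have := taylor_diff d0 n1' p (q - p) p' (q' - p')
  simpa only [add_sub_cancel] using this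

theorem Aop_eq {d m : ℕ} {σ : Vec d → Vec m →L[ℝ] Vec d} (hσ : IsC3Bounded σ) (z : Vec d)
    (X : Mat m) : Aop d m σ z X = ∑ i : Fin m, ∑ j : Fin m, X (i, j) • Dvf d m σ i j z := by
  unfold Aop
  rw [Lam_apply]
  refine Finset.sum_congr rfl fun i _ => Finset.sum_congr rfl fun j _ => ?_
  congr 1
  have d0 : HasFDerivAt σ (fderiv ℝ σ z) z := (hσ.1.differentiable (by norm_num) z).hasFDerivAt
  have := (d0.clm_apply (hasFDerivAt_const (EuclideanSpace.single j (1 : ℝ)) z)).fderiv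
  unfold Dvf
  rw [this]
  simp

theorem sol_of {d m : ℕ} {κ γ T L : ℝ} (hγ : 0 ≤ γ)
    {σ : Vec d → Vec m →L[ℝ] Vec d} (hσ : IsC3Bounded σ)
    {x : ℝ → Vec m} {X : ℝ → ℝ → Mat m} {a : Vec d} {y : ℝ → Vec d}
    (hr : IsRoughPath m γ 0 T x X) (hs : IsRDESolution d m (3 * κ) T σ x X a y)
    (h1 : holderInftyNorm γ 0 T x ≤ L) (h2 : (holder2ENorm (2 * γ) 0 T X).toReal ≤ L) :
    Sol σ (fderiv ℝ σ) (Aop d m σ) κ γ T L x X y where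
  hx s t a1 a2 a3 := (holder_bound hr.1 a1 a2 a3).trans (mul_le_mul_of_nonneg_right
    ((holder_le_infty hγ hr.1).trans h1) (Real.rpow_nonneg (by linarith) _))
  hX s t a1 a2 a3 := (holder2_bound hr.2.2.1 (diag_zero hr) a1 a2 a3).trans
    (mul_le_mul_of_nonneg_right h2 (Real.rpow_nonneg (by linarith) _))
  chen z s u t a1 a2 a3 a4 := by
    rw [← map_sub, ← map_sub]
    unfold Aop
    rw [Lam_apply]
    have := bil_exp (ContinuousLinearMap.compL ℝ (Vec m) (Vec d) (Vec m →L[ℝ] Vec d)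
      (fderiv ℝ σ z) (σ z)) (x u - x s) (x t - x u)
    refine Eq.trans ?_ this.symm
    refine Finset.sum_congr rfl fun i _ => Finset.sum_congr rfl fun j _ => ?_
    congr 1
    simpa using hr.2.2.2 s u t a1 a2 a3 a4 i j
  cont := hs.1
  J := by
    obtain ⟨C, hC⟩ := hs.2.2
    refine ⟨C, fun s t a1 a2 a3 => ?_⟩
    unfold Jf
    rw [Aop_eq hσ]
    exact hC s t a1 a2 a3

end Ito

/-- **Local Lipschitz continuity of the Itô map.** There is a function `K_T : ℝ⁴ → [0,∞)`,
nondecreasing in each argument and depending only on `T, σ, γ, κ, d, m`, such that for any two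
γ-rough paths and initial conditions, the corresponding solutions `y, yT` (with exponent `3κ`)
satisfy `‖y - yT‖_{γ,∞,T} ≤ K_T(‖x‖_{γ,∞,T}, ‖xT‖_{γ,∞,T}, ‖X²‖_{2γ}, ‖X̃²‖_{2γ}) ·
(|a - aT| + ‖x - xT‖_{γ,∞,T} + ‖X² - X̃²‖_{2γ})`. -/
theorem ito_map_locally_lipschitz (d m : ℕ) (κ γ T : ℝ)
    (hκ : 1 / 3 < κ) (hκγ : κ < γ) (hγ : γ ≤ 1) (hT : 0 < T)
    (σ : Vec d → Vec m →L[ℝ] Vec d) (hσ : IsC3Bounded σ) :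
    ∃ K : ℝ → ℝ → ℝ → ℝ → ℝ,
      (∀ r₁ r₂ r₃ r₄, 0 ≤ K r₁ r₂ r₃ r₄) ∧
      (∀ r₁ r₂ r₃ r₄ q₁ q₂ q₃ q₄, r₁ ≤ q₁ → r₂ ≤ q₂ → r₃ ≤ q₃ → r₄ ≤ q₄ →
        K r₁ r₂ r₃ r₄ ≤ K q₁ q₂ q₃ q₄) ∧
      ∀ (x xT : ℝ → Vec m) (X2 X2T : ℝ → ℝ → Mat m) (a aT : Vec d) (y yT : ℝ → Vec d),
        IsRoughPath m γ 0 T x X2 → IsRoughPath m γ 0 T xT X2T →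
        IsRDESolution d m (3 * κ) T σ x X2 a y →
        IsRDESolution d m (3 * κ) T σ xT X2T aT yT →
        supENorm 0 T (fun t => y t - yT t) + holderENorm γ 0 T (fun t => y t - yT t) ≤
          ENNReal.ofReal
            (K (holderInftyNorm γ 0 T x) (holderInftyNorm γ 0 T xT)
                ((holder2ENorm (2 * γ) 0 T X2).toReal)
                ((holder2ENorm (2 * γ) 0 T X2T).toReal) *
              (‖a - aT‖ + holderInftyNorm γ 0 T (fun t => x t - xT t) +
                (holder2ENorm (2 * γ) 0 T (fun s t => X2 s t - X2T s t)).toReal)) := by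
  classical
  obtain ⟨B, H⟩ := Ito.coef_of_C3 hσ
  have hγ0 : 0 ≤ γ := by linarith
  have hcore := fun n : ℕ => Ito.core (L := (n : ℝ) + 1) H hκ hκγ hγ
    (by linarith [n.cast_nonneg (α := ℝ)]) hT
  choose F hF0 hF using hcore
  let K : ℝ → ℝ → ℝ → ℝ → ℝ := fun r₁ r₂ r₃ r₄ =>
    ∑ k ∈ Finset.range (⌈max (max r₁ r₂) (max r₃ r₄)⌉₊ + 1), 2 * F k
  refine ⟨K, fun r₁ r₂ r₃ r₄ => Finset.sum_nonneg fun k _ => by linarith [hF0 k], ?_, ?_⟩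
  · intro r₁ r₂ r₃ r₄ q₁ q₂ q₃ q₄ h1 h2 h3 h4
    refine Finset.sum_le_sum_of_subset_of_nonneg ?_ (fun k _ _ => by linarith [hF0 k])
    refine Finset.range_mono (Nat.add_le_add_right (Nat.ceil_mono ?_) 1)
    exact max_le_max (max_le_max h1 h2) (max_le_max h3 h4)
  · intro x xT X2 X2T a aT y yT hr hrT hs hsT
    set r₁ := holderInftyNorm γ 0 T x
    set r₂ := holderInftyNorm γ 0 T xT
    set r₃ := (holder2ENorm (2 * γ) 0 T X2).toReal
    set r₄ := (holder2ENorm (2 * γ) 0 T X2T).toReal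
    set n := ⌈max (max r₁ r₂) (max r₃ r₄)⌉₊ with hn
    have hle : max (max r₁ r₂) (max r₃ r₄) ≤ (n : ℝ) + 1 :=
      (Nat.le_ceil _).trans (by linarith)
    have l1 : r₁ ≤ (n : ℝ) + 1 := ((le_max_left _ _).trans (le_max_left _ _)).trans hle
    have l2 : r₂ ≤ (n : ℝ) + 1 := ((le_max_right _ _).trans (le_max_left _ _)).trans hle
    have l3 : r₃ ≤ (n : ℝ) + 1 := ((le_max_left _ _).trans (le_max_right _ _)).trans hle
    have l4 : r₄ ≤ (n : ℝ) + 1 := ((le_max_right _ _).trans (le_max_right _ _)).trans hle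
    have S1 := Ito.sol_of hγ0 hσ hr hs l1 l3
    have S2 := Ito.sol_of hγ0 hσ hrT hsT l2 l4
    have dxf : holderENorm γ 0 T (fun t => x t - xT t) < ⊤ := by
      refine (Ito.holder_le (C := ((n : ℝ) + 1) + ((n : ℝ) + 1)) ?_).trans_lt ENNReal.ofReal_lt_top
      intro s t h1 h2 h3
      have e : (x t - xT t) - (x s - xT s) = (x t - x s) - (xT t - xT s) := by abel
      rw [e, add_mul]
      exact (norm_sub_le _ _).trans (add_le_add (S1.hx s t h1 h2 h3) (S2.hx s t h1 h2 h3))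
    have dXf : holder2ENorm (2 * γ) 0 T (fun s t => X2 s t - X2T s t) < ⊤ := by
      refine (Ito.holder2_le (C := ((n : ℝ) + 1) + ((n : ℝ) + 1)) ?_).trans_lt ENNReal.ofReal_lt_top
      intro s t h1 h2 h3
      rw [add_mul]
      exact (norm_sub_le _ _).trans (add_le_add (S1.hX s t h1 h2 h3) (S2.hX s t h1 h2 h3))
    have i1 := Ito.holder_le_infty hγ0 dxf
    set ε₁ := holderInftyNorm γ 0 T (fun t => x t - xT t)
    have b1 : 0 ≤ ε₁ := ENNReal.toReal_nonneg
    have b2 : 0 ≤ (holder2ENorm (2 * γ) 0 T (fun s t => X2 s t - X2T s t)).toReal :=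
      ENNReal.toReal_nonneg
    have b3 := norm_nonneg (a - aT)
    have dX := fun s t h1 h2 h3 => Ito.holder2_bound dXf (fun s h1 h2 => by
      simp only [Ito.diag_zero hr s h1 h2, Ito.diag_zero hrT s h1 h2, sub_self])
      (s := s) (t := t) h1 h2 h3
    set ε₂ := (holder2ENorm (2 * γ) 0 T (fun s t => X2 s t - X2T s t)).toReal
    set ε := ‖a - aT‖ + ε₁ + ε₂ with hε
    have hε0 : 0 ≤ ε := by positivity
    obtain ⟨g1, g2⟩ := hF n x xT X2 X2T y yT ε hε0 S1 S2
      (fun s t h1 h2 h3 => by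
        have e : (x t - x s) - (xT t - xT s) = (x t - xT t) - (x s - xT s) := by abel
        rw [e]
        exact (Ito.holder_bound dxf h1 h2 h3).trans (mul_le_mul_of_nonneg_right (by linarith)
          (Real.rpow_nonneg (by linarith) _)))
      (fun s t h1 h2 h3 => (dX s t h1 h2 h3).trans (mul_le_mul_of_nonneg_right (by linarith)
          (Real.rpow_nonneg (by linarith) _)))
      (by rw [hs.2.1, hsT.2.1]; linarith)
    have hFε : 0 ≤ F n * ε := mul_nonneg (hF0 n) hε0
    refine (add_le_add (Ito.sup_le g1) (Ito.holder_le g2)).trans ?_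
    rw [← ENNReal.ofReal_add hFε hFε]
    refine ENNReal.ofReal_le_ofReal ?_
    have hK : 2 * F n ≤ K r₁ r₂ r₃ r₄ :=
      Finset.single_le_sum (f := fun k => 2 * F k) (fun k _ => by linarith [hF0 k])
        (Finset.self_mem_range_succ n)
    have := mul_le_mul_of_nonneg_right hK hε0
    linarith

end
end
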